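/- Let A be a simple, non-elementary C*-algebra. Then the set Cu(A)_wdiv of elements x ∈ Cu(A) with wdiv_{2m}(x) < ∞ for some m ≥ 1 is sup-dense in Cu(A). If moreover A is not stably finite, then Cu(A)_wdiv = Cu(A). -/

import Mathlib

/-!
Common definitions: abstract Cuntz semigroups, divisibility, and C*-algebra notions
(nowhere scatteredness, σ-unitality, etc.) used to formalize the statements.
-/

open scoped MultiplierAlgebra ENNReal
open Filter Topology

noncomputable section

universe uu vv

/-- The (sequential) way-below relation `x ≪ y` (compact containment) in a partially
ordered set: whenever an increasing sequence has a supremum lying above `y`, some term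
of the sequence already lies above `x`. -/
def WayBelow {S : Type*} [PartialOrder S] (x y : S) : Prop :=
  ∀ f : ℕ → S, Monotone f → ∀ s : S, IsLUB (Set.range f) s → y ≤ s → ∃ n, x ≤ f n

/-- An abstract Cuntz semigroup (`Cu`-semigroup): a positively ordered abelian monoid in
which every increasing sequence has a supremum, every element is the supremum of a
`≪`-increasing sequence, addition preserves `≪`, and which satisfies the standard
axioms (O5) (almost algebraic order) and (O6) (almost Riesz decomposition), as well as
the existence of infima with idempotents `∞y = sup_n n•y` (all of these hold in the
Cuntz semigroup of any C*-algebra). -/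
class CuSemigroup (S : Type*) extends AddCommMonoid S, PartialOrder S where
  add_le_add' : ∀ a b : S, a ≤ b → ∀ c : S, c + a ≤ c + b
  zero_le' : ∀ x : S, 0 ≤ x
  exists_isLUB : ∀ f : ℕ → S, Monotone f → ∃ s : S, IsLUB (Set.range f) s
  exists_waybelow_seq : ∀ x : S, ∃ f : ℕ → S, Monotone f ∧
    (∀ n, WayBelow (f n) (f (n + 1))) ∧ IsLUB (Set.range f) x
  waybelow_add : ∀ {x y z w : S}, WayBelow x y → WayBelow z w → WayBelow (x + z) (y + w)
  /-- axiom (O5) -/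
  almost_algebraic : ∀ x' x y' y z : S, WayBelow x' x → WayBelow y' y → x + y ≤ z →
    ∃ c : S, y' ≤ c ∧ x' + c ≤ z ∧ z ≤ x + c
  /-- axiom (O6) -/
  almost_riesz : ∀ x' x y z : S, WayBelow x' x → x ≤ y + z →
    ∃ v w : S, v ≤ x ∧ v ≤ y ∧ w ≤ x ∧ w ≤ z ∧ x' ≤ v + w
  /-- `infty y = ∞·y = sup_n n•y` -/
  infty : S → S
  isLUB_infty : ∀ y : S, IsLUB (Set.range fun n : ℕ => n • y) (infty y)
  /-- the infimum `x ⊓ ∞y`, which exists in the Cuntz semigroup of any C*-algebra -/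
  meetInfty : S → S → S
  isGLB_meetInfty : ∀ x y : S, IsGLB {x, infty y} (meetInfty x y)

namespace CuDiv

variable {S : Type*} [CuSemigroup S]

/-- `x` is weakly `(m, n)`-divisible. -/
def IsWeaklyDivisible (m n : ℕ) (x : S) : Prop :=
  ∀ x' : S, WayBelow x' x → ∃ y : Fin n → S, x' ≤ ∑ j, y j ∧ ∀ j, m • y j ≤ x

/-- `x` is `(m, n)`-divisible. -/
def IsDivisible (m n : ℕ) (x : S) : Prop :=
  ∀ x' : S, WayBelow x' x → ∃ y : S, x' ≤ n • y ∧ m • y ≤ x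

/-- `x` is weakly `(m, ω)`-divisible. -/
def IsWeaklyOmegaDivisible (m : ℕ) (x : S) : Prop :=
  ∀ x' : S, WayBelow x' x → ∃ (n : ℕ) (y : Fin n → S), x' ≤ ∑ j, y j ∧ ∀ j, m • y j ≤ x

/-- `x` is `(m, ω)`-divisible. -/
def IsOmegaDivisible (m : ℕ) (x : S) : Prop :=
  ∀ x' : S, WayBelow x' x → ∃ (y : S) (n : ℕ), x' ≤ n • y ∧ m • y ≤ x

/-- `wdiv m x` is the least positive integer `n` such that `x` is weakly
`(m,n)`-divisible, and `∞` if there is no such `n`. -/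
def wdiv (m : ℕ) (x : S) : ℕ∞ :=
  sInf {N : ℕ∞ | ∃ n : ℕ, 1 ≤ n ∧ N = n ∧ IsWeaklyDivisible m n x}

/-- `Div m x` is the least positive integer `n` such that `x` is `(m,n)`-divisible,
and `∞` if there is no such `n`. -/
def Div (m : ℕ) (x : S) : ℕ∞ :=
  sInf {N : ℕ∞ | ∃ n : ℕ, 1 ≤ n ∧ N = n ∧ IsDivisible m n x}

/-- An element `x` is strongly soft if for every `x' ≪ x` there is `t` with
`x' + t ≤ x ≤ ∞t`. -/
def StronglySoft (x : S) : Prop :=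
  ∀ x' : S, WayBelow x' x → ∃ t : S, x' + t ≤ x ∧ x ≤ CuSemigroup.infty t

/-- The Cuntz semigroup characterization of the Global Glimm Property: every element is
`(m, ω)`-divisible for every `m`. -/
def GlobalGlimm (S : Type*) [CuSemigroup S] : Prop :=
  ∀ (m : ℕ) (x : S), IsOmegaDivisible m x

/-- `Cu(A)` is left-soft separative. -/
def LeftSoftSeparative (S : Type*) [CuSemigroup S] : Prop :=
  ∀ x y t : S, StronglySoft x → WayBelow (x + t) (y + t) →
    WayBelow t (CuSemigroup.infty y) → WayBelow t (CuSemigroup.infty x) → WayBelow x y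

/-- `Cu(A)` is weakly cancellative. -/
def WeaklyCancellative (S : Type*) [CuSemigroup S] : Prop :=
  ∀ x y z : S, WayBelow (x + z) (y + z) → WayBelow x y

/-- `Cu(A)` has covering dimension zero. -/
def CoveringDimZero (S : Type*) [CuSemigroup S] : Prop :=
  ∀ x' x y₁ y₂ : S, WayBelow x' x → WayBelow x (y₁ + y₂) →
    ∃ z₁ z₂ : S, z₁ ≤ y₁ ∧ z₂ ≤ y₂ ∧ x' ≤ z₁ + z₂ ∧ z₁ + z₂ ≤ x

end CuDiv

/-- A functional on a Cuntz semigroup: an additive, order preserving map to `ℝ≥0∞`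
preserving suprema of increasing sequences.  (By Elliott–Robert–Santiago, the
functionals on `Cu(A)` are exactly those induced by the lower semicontinuous
2-quasitraces on `A ⊗ K`.) -/
structure CuFunctional (S : Type*) [CuSemigroup S] where
  toFun : S → ℝ≥0∞
  map_zero' : toFun 0 = 0
  map_add' : ∀ x y : S, toFun (x + y) = toFun x + toFun y
  mono' : ∀ x y : S, x ≤ y → toFun x ≤ toFun y
  sup' : ∀ f : ℕ → S, Monotone f → ∀ s : S, IsLUB (Set.range f) s →
    toFun s = ⨆ n, toFun (f n)

instance {S : Type*} [CuSemigroup S] : CoeFun (CuFunctional S) fun _ => S → ℝ≥0∞ :=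
  ⟨CuFunctional.toFun⟩

namespace CuDiv

variable {S : Type*} [CuSemigroup S]

/-- `x <ₛ y` : there is `γ < 1` with `λ(x) ≤ γ·λ(y)` for every functional `λ`. -/
def FunctionalLT (x y : S) : Prop :=
  ∃ γ : ℝ≥0∞, γ < 1 ∧ ∀ lam : CuFunctional S, lam x ≤ γ * lam y

/-- `A` has `k`-comparison (stated on `Cu(A)`). -/
def KComparison (S : Type*) [CuSemigroup S] (k : ℕ) : Prop :=
  ∀ (x : S) (b : Fin (k + 1) → S), (∀ i, FunctionalLT x (b i)) → x ≤ ∑ i, b i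

/-- `A` has strict comparison (stated on `Cu(A)`, via functionals, which correspond to
the lower semicontinuous 2-quasitraces). -/
def StrictComparison (S : Type*) [CuSemigroup S] : Prop :=
  ∀ x y : S, FunctionalLT x y → x ≤ y

/-- The natural topology on the cone `F(Cu(A))` of functionals. -/
def functionalTopology (S : Type*) [CuSemigroup S] : TopologicalSpace (CuFunctional S) :=
  TopologicalSpace.generateFrom
    ({U | ∃ (x : S) (r : ℝ≥0∞), U = {lam : CuFunctional S | r < lam x}} ∪
      {U | ∃ (x' x : S) (r : ℝ≥0∞), WayBelow x' x ∧ U = {lam : CuFunctional S | lam x' < r}})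

/-- A lower semicontinuous affine function on the cone of functionals of `Cu(A)`,
i.e. an element of `L(F(Cu(A)))`. -/
def IsLscAffine (F : CuFunctional S → ℝ≥0∞) : Prop :=
  (letI := functionalTopology S; LowerSemicontinuous F) ∧
    (∀ lam mu nu : CuFunctional S, (∀ x, nu x = lam x + mu x) → F nu = F lam + F mu) ∧
    (∀ (r : ℝ≥0∞) (lam nu : CuFunctional S), (∀ x, nu x = r * lam x) → F nu = r * F lam)

/-- The rank map of `Cu(A)` is surjective: every lower semicontinuous affine function on
the cone of functionals is realized as the rank function `λ ↦ λ(x)` of an element. -/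
def SurjectiveRankMap (S : Type*) [CuSemigroup S] : Prop :=
  ∀ F : CuFunctional S → ℝ≥0∞, IsLscAffine F → ∃ y : S, ∀ lam : CuFunctional S, lam y = F lam

end CuDiv

/-! ### C*-algebra notions -/

section CStar

variable {B : Type*} [NonUnitalCStarAlgebra B]

/-- Positivity in a C*-algebra: `a` is positive iff it is of the form `star b * b`. -/
def CStarNonneg (a : B) : Prop := ∃ b : B, a = star b * b

/-- Cuntz subequivalence `a ≼ b` : `a = lim_n rₙ b rₙ*`. -/
def CuntzBelow (a b : B) : Prop :=
  ∃ r : ℕ → B, Tendsto (fun n => r n * b * star (r n)) atTop (𝓝 a)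

/-- Cuntz equivalence. -/
def CuntzEquiv (a b : B) : Prop := CuntzBelow a b ∧ CuntzBelow b a

/-- `A` is σ-unital: it has a countable (norm-bounded, positive) approximate unit. -/
def SigmaUnital (A : Type*) [NonUnitalCStarAlgebra A] : Prop :=
  ∃ e : ℕ → A, (∀ n, CStarNonneg (e n) ∧ ‖e n‖ ≤ 1) ∧
    ∀ a : A, Tendsto (fun n => e n * a) atTop (𝓝 a) ∧ Tendsto (fun n => a * e n) atTop (𝓝 a)

end CStar

/-- A closed two-sided (automatically star-closed) ideal of a C*-algebra. -/
structure ClosedTwoSidedIdealC (A : Type*) [NonUnitalCStarAlgebra A] where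
  carrier : NonUnitalStarSubalgebra ℂ A
  isClosed : IsClosed (carrier : Set A)
  mul_mem_left : ∀ a : A, ∀ x ∈ carrier, a * x ∈ carrier
  mul_mem_right : ∀ a : A, ∀ x ∈ carrier, x * a ∈ carrier

section Reps

variable {A : Type*} [NonUnitalCStarAlgebra A]
variable {H : Type*} [NormedAddCommGroup H] [InnerProductSpace ℂ H] [CompleteSpace H]

/-- A (topologically) irreducible representation of `A` on a Hilbert space `H`. -/
def IsIrreducibleRep (π : A →⋆ₙₐ[ℂ] (H →L[ℂ] H)) : Prop :=
  (∃ a : A, π a ≠ 0) ∧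
    ∀ K : Submodule ℂ H, IsClosed (K : Set H) → (∀ a : A, ∀ v ∈ K, π a v ∈ K) →
      K = ⊥ ∨ K = ⊤

end Reps

/-- `A` has a nonzero elementary ideal-quotient `J/I`, expressed via a surjection of a
closed two-sided ideal `J` of `A` onto the algebra of compact operators on a Hilbert
space (the kernel `I` of such a `*`-homomorphism is automatically a closed two-sided
ideal of `A`, and conversely any nonzero elementary ideal-quotient arises this way). -/
def HasNonzeroElementaryIdealQuotient (A : Type*) [NonUnitalCStarAlgebra A] : Prop :=
  ∃ (J : ClosedTwoSidedIdealC A) (H : Type) (_ : NormedAddCommGroup H)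
    (_ : InnerProductSpace ℂ H) (_ : CompleteSpace H)
    (ψ : J.carrier →⋆ₙₐ[ℂ] (H →L[ℂ] H)),
      Set.range ψ = {T : H →L[ℂ] H | IsCompactOperator ⇑T} ∧ ∃ x, ψ x ≠ 0

/-- A C*-algebra is nowhere scattered if no ideal-quotient of it is nonzero and
elementary. -/
def NowhereScattered (A : Type*) [NonUnitalCStarAlgebra A] : Prop :=
  ¬ HasNonzeroElementaryIdealQuotient A

/-- A C*-algebra is elementary if it is isomorphic to the algebra of compact operators
on some Hilbert space. -/
def IsElementaryCStar (A : Type*) [NonUnitalCStarAlgebra A] : Prop :=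
  ∃ (H : Type) (_ : NormedAddCommGroup H) (_ : InnerProductSpace ℂ H) (_ : CompleteSpace H)
    (ψ : A →⋆ₙₐ[ℂ] (H →L[ℂ] H)),
      Function.Injective ψ ∧ Set.range ψ = {T : H →L[ℂ] H | IsCompactOperator ⇑T}

/-- A C*-algebra is simple if it is nonzero and has no nontrivial closed two-sided
ideals. -/
def IsSimpleCStar (A : Type*) [NonUnitalCStarAlgebra A] : Prop :=
  (∃ a : A, a ≠ 0) ∧
    ∀ J : ClosedTwoSidedIdealC A, (J.carrier : Set A) = {0} ∨ (J.carrier : Set A) = Set.univ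

/-- Real rank zero: the invertible self-adjoint elements are dense in the self-adjoint
part of the minimal unitization. -/
def RealRankZero (A : Type*) [NonUnitalCStarAlgebra A] : Prop :=
  ∀ x : Unitization ℂ A, IsSelfAdjoint x →
    x ∈ closure {y : Unitization ℂ A | IsSelfAdjoint y ∧ IsUnit y}

/-- Stable rank one: the invertible elements are dense in the minimal unitization. -/
def StableRankOne (A : Type*) [NonUnitalCStarAlgebra A] : Prop :=
  ∀ x : Unitization ℂ A, x ∈ closure {y : Unitization ℂ A | IsUnit y}

section CP

variable {A B : Type*} [NonUnitalCStarAlgebra A] [NonUnitalCStarAlgebra B]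

/-- A linear map between C*-algebras is completely positive if all of its matrix
amplifications preserve positivity. -/
def IsCompletelyPositive (φ : A →ₗ[ℂ] B) : Prop :=
  ∀ (n : ℕ) (a : Matrix (Fin n) (Fin n) A), (∃ b : Matrix (Fin n) (Fin n) A, a = star b * b) →
    ∃ c : Matrix (Fin n) (Fin n) B, a.map ⇑φ = star c * c

/-- A completely positive contractive (c.p.c.) map. -/
def IsCPC (φ : A →ₗ[ℂ] B) : Prop :=
  IsCompletelyPositive φ ∧ ∀ a : A, ‖φ a‖ ≤ ‖a‖

/-- A map between C*-algebras has order zero if it preserves orthogonality of positive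
elements. -/
def IsOrderZero (φ : A →ₗ[ℂ] B) : Prop :=
  ∀ a b : A, CStarNonneg a → CStarNonneg b → a * b = 0 → φ a * φ b = 0

end CP

/-- `A` has nuclear dimension at most `k`: there are c.p.c. approximations of the
identity through finite dimensional C*-algebras in which the downwards maps are sums of
`k+1` c.p.c. order zero maps. -/
def NuclearDimLE (A : Type*) [NonUnitalCStarAlgebra A] (k : ℕ) : Prop :=
  ∀ (F : Finset A) (ε : ℝ), 0 < ε →
    ∃ (Fd : Type) (_ : NonUnitalCStarAlgebra Fd) (_ : FiniteDimensional ℂ Fd)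
      (ψ : A →ₗ[ℂ] Fd) (φ : Fin (k + 1) → (Fd →ₗ[ℂ] A)),
        IsCPC ψ ∧ (∀ i, IsCPC (φ i) ∧ IsOrderZero (φ i)) ∧
        ∀ a ∈ F, ‖(∑ i, φ i (ψ a)) - a‖ ≤ ε

section Prim

variable (A : Type*) [NonUnitalCStarAlgebra A]

/-- A primitive ideal: the kernel of an irreducible representation. -/
def IsPrimitiveIdeal {A : Type*} [NonUnitalCStarAlgebra A] (J : ClosedTwoSidedIdealC A) : Prop :=
  ∃ (H : Type) (_ : NormedAddCommGroup H) (_ : InnerProductSpace ℂ H) (_ : CompleteSpace H)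
    (π : A →⋆ₙₐ[ℂ] (H →L[ℂ] H)),
      IsIrreducibleRep π ∧ ∀ a : A, a ∈ J.carrier ↔ π a = 0

/-- The primitive ideal space of `A`. -/
def PrimIdealSpace := {J : ClosedTwoSidedIdealC A // IsPrimitiveIdeal J}

/-- The hull-kernel (Jacobson) topology on the primitive ideal space. -/
instance : TopologicalSpace (PrimIdealSpace A) :=
  TopologicalSpace.generateFrom {U | ∃ a : A, U = {P : PrimIdealSpace A | a ∉ P.1.carrier}}

/-- `A` has topological dimension zero: the primitive ideal space has a basis of
compact open sets. -/
def TopDimZero : Prop :=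
  ∃ 𝒷 : Set (Set (PrimIdealSpace A)), TopologicalSpace.IsTopologicalBasis 𝒷 ∧
    ∀ U ∈ 𝒷, IsCompact U ∧ IsOpen U

end Prim

section Proj

variable {B : Type*} [NonUnitalCStarAlgebra B]

/-- A projection in a C*-algebra. -/
def IsProjectionElem (p : B) : Prop := IsSelfAdjoint p ∧ p * p = p

/-- `B` contains an infinite projection: a projection which is Murray-von Neumann
equivalent to a proper subprojection of itself. -/
def HasInfiniteProjection (B : Type*) [NonUnitalCStarAlgebra B] : Prop :=
  ∃ p v : B, IsProjectionElem p ∧ star v * v = p ∧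
    p * (v * star v) = v * star v ∧ v * star v ≠ p

end Proj

/-! ### The Cuntz semigroup of a C*-algebra -/

/-- Padding a matrix by one extra row and column of zeros. -/
def matPad {A : Type*} [Zero A] {n : ℕ} (a : Matrix (Fin n) (Fin n) A) :
    Matrix (Fin (n + 1)) (Fin (n + 1)) A :=
  Matrix.of fun i j =>
    if h : (i : ℕ) < n ∧ (j : ℕ) < n then a ⟨i, h.1⟩ ⟨j, h.2⟩ else 0

/-- A witness that `S` is the Cuntz semigroup of the C*-algebra `A`: it provides a
stabilization `stab` of `A` (a model of `A ⊗ K`, described as the C*-completion of the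
union of the matrix algebras `Mₙ(A)`), together with the class map
`cls : (stab)₊ → S = Cu(A)` identifying `S` with the set of Cuntz equivalence classes of
positive elements of `A ⊗ K`, with order induced by Cuntz subequivalence, addition
induced by orthogonal (diagonal) addition, and with the compact containment relation
`≪` given by `x ≪ [a]` iff `x ≤ [(a - ε)₊]` for some `ε > 0`. -/
structure IsCuntzSemigroupOf (A : Type uu) [NonUnitalCStarAlgebra A]
    (S : Type vv) [CuSemigroup S] where
  stab : Type (max uu vv)
  [stabCStar : NonUnitalCStarAlgebra stab]
  matEmb : (n : ℕ) → (Matrix (Fin n) (Fin n) A →⋆ₙₐ[ℂ] stab)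
  matEmb_injective : ∀ n, Function.Injective (matEmb n)
  matEmb_compat : ∀ (n : ℕ) (a : Matrix (Fin n) (Fin n) A), matEmb (n + 1) (matPad a) = matEmb n a
  matEmb_dense : Dense (⋃ n, Set.range (matEmb n))
  cls : stab → S
  cls_zero : cls 0 = 0
  cls_surj : ∀ s : S, ∃ b : stab, CStarNonneg b ∧ cls b = s
  cls_le_iff : ∀ a b : stab, CStarNonneg a → CStarNonneg b → (cls a ≤ cls b ↔ CuntzBelow a b)
  cls_add_orth : ∀ a b : stab, CStarNonneg a → CStarNonneg b → a * b = 0 →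
    cls (a + b) = cls a + cls b
  exists_orth : ∀ a b : stab, CStarNonneg a → CStarNonneg b →
    ∃ a' b' : stab, CStarNonneg a' ∧ CStarNonneg b' ∧ a' * b' = 0 ∧
      cls a' = cls a ∧ cls b' = cls b
  waybelow_iff : ∀ (x : S) (a : stab), CStarNonneg a →
    (WayBelow x (cls a) ↔ ∃ ε : ℝ, 0 < ε ∧ x ≤ cls (cfcₙ (fun t : ℝ => max (t - ε) 0) a))

attribute [instance] IsCuntzSemigroupOf.stabCStar

/-- The Cuntz class `[a] ∈ Cu(A)` of an element `a` of `A` itself (via the canonical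
embedding `A ≅ M₁(A) ⊆ A ⊗ K`). -/
def IsCuntzSemigroupOf.clsA {A : Type*} [NonUnitalCStarAlgebra A] {S : Type*} [CuSemigroup S]
    (h : IsCuntzSemigroupOf A S) (a : A) : S :=
  h.cls (h.matEmb 1 (Matrix.of fun _ _ => a))

/-- `B` has a surjective rank map (every lower semicontinuous affine function on the
cone of functionals on `Cu(B)` is realized as a rank function). -/
def HasSurjectiveRankMap (B : Type*) [NonUnitalCStarAlgebra B] : Prop :=
  ∀ (S : Type) (inst : CuSemigroup S), IsCuntzSemigroupOf B S → CuDiv.SurjectiveRankMap S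

/-- The family of separable sub-C*-algebras of `A` having a surjective rank map. -/
def sepSurjRankFamily (A : Type*) [NonUnitalCStarAlgebra A] :
    Set (NonUnitalStarSubalgebra ℂ A) :=
  {B | ∃ _h : IsClosed (B : Set A),
    TopologicalSpace.SeparableSpace B ∧ HasSurjectiveRankMap B}

/-- The family of separable sub-C*-algebras of `A` with a surjective rank map is
σ-complete (closed under countable increasing unions) and cofinal (every separable
sub-C*-algebra is contained in a member). -/
def SepSurjRankFamilySigmaCompleteCofinal (A : Type*) [NonUnitalCStarAlgebra A] : Prop :=
  (∀ Bseq : ℕ → NonUnitalStarSubalgebra ℂ A, Monotone Bseq →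
    (∀ n, Bseq n ∈ sepSurjRankFamily A) →
      (⨆ n, Bseq n).topologicalClosure ∈ sepSurjRankFamily A) ∧
  (∀ C : NonUnitalStarSubalgebra ℂ A, IsClosed (C : Set A) →
    TopologicalSpace.SeparableSpace C → ∃ B ∈ sepSurjRankFamily A, C ≤ B)

end

/-! ### Cuntz comparison -/

section CuntzComparison

variable {B : Type*} [NonUnitalCStarAlgebra B]

theorem cuntzBelow_iff_mem_closure {a b : B} :
    CuntzBelow a b ↔ a ∈ closure (Set.range fun r : B => r * b * star r) := by
  rw [mem_closure_iff_seq_limit]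
  constructor
  · rintro ⟨r, hr⟩
    exact ⟨fun n => r n * b * star (r n), fun n => ⟨r n, rfl⟩, hr⟩
  · rintro ⟨x, hx, hlim⟩
    choose r hr using hx
    exact ⟨r, by simpa only [hr] using hlim⟩

theorem cuntzBelow_conj (r b : B) : CuntzBelow (r * b * star r) b :=
  cuntzBelow_iff_mem_closure.2 (subset_closure ⟨r, rfl⟩)

theorem eq_zero_of_cuntzBelow_zero {a : B} (h : CuntzBelow a 0) : a = 0 := by
  obtain ⟨r, hr⟩ := h
  simp only [mul_zero, zero_mul] at hr
  exact tendsto_nhds_unique hr tendsto_const_nhds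

theorem cuntzBelow_of_tendsto {s w y : B} {r : ℕ → B} (hs : star s = s) (hy : s * s = y)
    (hr : Tendsto (fun n => r n * s) atTop (𝓝 w)) : CuntzBelow (w * star w) y := by
  refine ⟨r, ?_⟩
  convert hr.mul hr.star using 2 with n
  rw [star_mul, hs, ← hy]
  simp only [mul_assoc]

variable [PartialOrder B] [StarOrderedRing B]

theorem cstarNonneg_iff_nonneg {a : B} : CStarNonneg a ↔ 0 ≤ a :=
  CStarAlgebra.nonneg_iff_eq_star_mul_self.symm

/-- A positive element has a self-adjoint square root `s`, together with self-adjoint elements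
`h n` commuting with `s` such that the `h n * s` form an approximate unit for `s`. -/
theorem exists_sqrt_approxUnit {y : B} (hy : 0 ≤ y) :
    ∃ (s : B) (h : ℕ → B), star s = s ∧ s * s = y ∧
      (∀ n, star (h n) = h n ∧ h n * s = s * h n) ∧
      Tendsto (fun n => h n * s * s) atTop (𝓝 s) := by
  have hsa : IsSelfAdjoint y := .of_nonneg hy
  have hnn : ∀ t ∈ quasispectrum ℝ y, 0 ≤ t := quasispectrum_nonneg_of_nonneg y hy
  set g : ℕ → ℝ → ℝ := fun n t => √t / (|t| + (1 / ((n : ℝ) + 1)) ^ 2) with hg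
  have hden : ∀ (n : ℕ) (t : ℝ), |t| + (1 / ((n : ℝ) + 1)) ^ 2 ≠ 0 := fun n t => by positivity
  have hgc : ∀ n, Continuous (g n) := fun n =>
    Real.continuous_sqrt.div (by fun_prop) (hden n)
  have hg0 : ∀ n, g n 0 = 0 := fun n => by simp [hg]
  have hsc : Continuous Real.sqrt := Real.continuous_sqrt
  refine ⟨cfcₙ Real.sqrt y, fun n => cfcₙ (g n) y, IsSelfAdjoint.cfcₙ, ?_, fun n =>
    ⟨IsSelfAdjoint.cfcₙ, cfcₙ_commute_cfcₙ _ _ _⟩, ?_⟩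
  · rw [← cfcₙ_mul _ _ y hsc.continuousOn (by simp) hsc.continuousOn (by simp)]
    conv_rhs => rw [← cfcₙ_id' ℝ y]
    exact cfcₙ_congr fun t ht => Real.mul_self_sqrt (hnn t ht)
  · rw [tendsto_iff_norm_sub_tendsto_zero]
    refine squeeze_zero (fun _ => norm_nonneg _) (fun n => ?_)
      tendsto_one_div_add_atTop_nhds_zero_nat
    rw [← cfcₙ_mul _ _ y (hgc n).continuousOn (hg0 n) hsc.continuousOn (by simp),
      ← cfcₙ_mul (fun t => g n t * √t) _ y ((hgc n).mul hsc).continuousOn (by simp)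
        hsc.continuousOn (by simp),
      ← cfcₙ_sub (fun t => g n t * √t * √t) _ y (((hgc n).mul hsc).mul hsc).continuousOn (by simp)
        hsc.continuousOn (by simp)]
    refine norm_cfcₙ_le fun t ht => ?_
    set δ : ℝ := 1 / ((n : ℝ) + 1) with hδ
    have hδ0 : 0 < δ := by positivity
    have ht0 := hnn t ht
    obtain ⟨u, hu, rfl⟩ : ∃ u : ℝ, 0 ≤ u ∧ u ^ 2 = t := ⟨√t, Real.sqrt_nonneg t, Real.sq_sqrt ht0⟩
    have hval : g n (u ^ 2) * √(u ^ 2) * √(u ^ 2) - √(u ^ 2) = -(u * δ ^ 2 / (u ^ 2 + δ ^ 2)) := by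
      simp only [hg, Real.sqrt_sq hu, abs_of_nonneg ht0, ← hδ]
      field_simp
      ring
    rw [hval, norm_neg, Real.norm_of_nonneg (by positivity), div_le_iff₀ (by positivity)]
    nlinarith [sq_nonneg (u - δ), mul_nonneg hu hδ0.le]

theorem cuntzBelow_of_le {x y : B} (hx : 0 ≤ x) (hxy : x ≤ y) : CuntzBelow x y := by
  obtain ⟨s, h, hs, hss, hh, hlim⟩ := exists_sqrt_approxUnit (hx.trans hxy)
  obtain ⟨t, -, ht, htt, -⟩ := exists_sqrt_approxUnit hx
  have key : ∀ n, ‖t * h n * s - t‖ ≤ ‖h n * s * s - s‖ := by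
    intro n
    obtain ⟨hn, hcomm⟩ := hh n
    have hks : star (h n * s) = h n * s := by rw [star_mul, hs, hn, hcomm]
    set k := h n * s with hk
    obtain ⟨w, hw⟩ := CStarAlgebra.nonneg_iff_eq_star_mul_self.1 (sub_nonneg.2 hxy)
    have h1 : star (t * k - t) * (t * k - t) = k * x * k - k * x - x * k + x := by
      simp only [star_sub, star_mul, hks, ht, ← htt]
      noncomm_ring
    have h2 : (k * s - s) * star (k * s - s) = k * y * k - k * y - y * k + y := by
      simp only [star_sub, star_mul, hks, hs, ← hss]
      noncomm_ring
    have h3 : star (t * k - t) * (t * k - t) ≤ (k * s - s) * star (k * s - s) := by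
      rw [← sub_nonneg]
      have : (k * s - s) * star (k * s - s) - star (t * k - t) * (t * k - t) =
          star (w * k - w) * (w * k - w) := by
        rw [h1, h2]
        have : y = star w * w + x := by rw [← hw]; abel
        rw [this]
        simp only [star_sub, star_mul, hks]
        noncomm_ring
      rw [this]
      exact star_mul_self_nonneg _
    have h4 := CStarAlgebra.norm_le_norm_of_nonneg_of_le (star_mul_self_nonneg _) h3
    rw [CStarRing.norm_star_mul_self, CStarRing.norm_self_mul_star] at h4
    rw [mul_assoc t]
    exact le_of_sq_le_sq (by simpa only [sq] using h4) (norm_nonneg _)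
  have : CuntzBelow (t * star t) y := by
    refine cuntzBelow_of_tendsto (r := fun n => t * h n) hs hss ?_
    rw [tendsto_iff_norm_sub_tendsto_zero] at hlim ⊢
    exact squeeze_zero (fun _ => norm_nonneg _) key hlim
  rwa [ht, htt] at this

theorem cuntzBelow_star_mul_self (w : B) : CuntzBelow (star w * w) (w * star w) := by
  obtain ⟨s, h, hs, hss, hh, hlim⟩ := exists_sqrt_approxUnit (star_mul_self_nonneg w)
  refine ⟨fun n => h n * star w, ?_⟩
  have := hlim.mul hlim.star
  rw [hs, hss] at this
  convert this using 2 with n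
  simp only [star_mul, star_star, hs, (hh n).1, mul_assoc]
  simp only [← mul_assoc s s, ← mul_assoc (star w) w, hss]

theorem cuntzBelow_add_of_orthogonal {x y a b : B} (ha : 0 ≤ a) (hb : 0 ≤ b) (hab : a * b = 0)
    (hx : CuntzBelow x a) (hy : CuntzBelow y b) : CuntzBelow (x + y) (a + b) := by
  obtain ⟨s, h, hs, hss, hh, hlim⟩ := exists_sqrt_approxUnit ha
  obtain ⟨t, g, ht, htt, hg, hlim'⟩ := exists_sqrt_approxUnit hb
  have hsb : s * b = 0 := by
    rw [← CStarRing.star_mul_self_eq_zero_iff, star_mul, hs, mul_assoc, ← mul_assoc s s, hss, hab,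
      mul_zero]
  have hst : s * t = 0 := by
    rw [← CStarRing.mul_star_self_eq_zero_iff, star_mul, ht, mul_assoc, ← mul_assoc t t, htt,
      ← mul_assoc, hsb, zero_mul]
  have hts : t * s = 0 := by rw [← hs, ← ht, ← star_mul, hst, star_zero]
  rw [cuntzBelow_iff_mem_closure] at hx hy ⊢
  rw [← closure_closure (s := Set.range _)]
  refine map_mem_closure₂ continuous_add hx hy ?_
  rintro _ ⟨r, rfl⟩ _ ⟨r', rfl⟩
  rw [← cuntzBelow_iff_mem_closure]
  refine ⟨fun n => r * h n * s + r' * g n * t, ?_⟩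
  have h1 := (hlim.const_mul r).mul (hlim.const_mul r).star
  have h2 := (hlim'.const_mul r').mul (hlim'.const_mul r').star
  have e1 : r * s * star (r * s) = r * a * star r := by
    rw [star_mul, hs, ← hss]; simp only [mul_assoc]
  have e2 : r' * t * star (r' * t) = r' * b * star r' := by
    rw [star_mul, ht, ← htt]; simp only [mul_assoc]
  rw [e1] at h1
  rw [e2] at h2
  refine (h1.add h2).congr fun n => ?_
  have f1 : (r * h n * s + r' * g n * t) * (s + t) = r * (h n * s * s) + r' * (g n * t * t) := by
    have : (r * h n * s + r' * g n * t) * (s + t) = r * (h n * s * s) + r' * (g n * t * t) +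
      r * h n * (s * t) + r' * g n * (t * s) := by noncomm_ring
    rw [this, hst, hts]; simp
  have f2 : a + b = (s + t) * star (s + t) := by
    rw [star_add, hs, ht, add_mul, mul_add, mul_add, hss, htt, hst, hts]; simp
  have f3 : r * (h n * s * s) * star (r' * (g n * t * t)) = 0 := by
    have : r * (h n * s * s) * star (r' * (g n * t * t)) =
      r * (h n * s * (s * t) * (t * star (g n) * star r')) := by
        simp only [star_mul, ht, mul_assoc]
    rw [this, hst]; simp
  have f4 : r' * (g n * t * t) * star (r * (h n * s * s)) = 0 := by
    rw [← star_star (r' * (g n * t * t)), ← star_mul, f3, star_zero]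
  beta_reduce
  rw [f2, ← mul_assoc (r * h n * s + r' * g n * t), f1,
    mul_assoc (_ + _), ← star_mul, f1, star_add, add_mul, mul_add, mul_add, f3, f4]
  simp

/-- If `a` is within `δ` of a self-adjoint element bounded above by `b`, then the cut-down
`(a - 2δ)₊` is Cuntz subequivalent to a conjugate of `b`. -/
theorem exists_cutDown_cuntzBelow_conj {a b c : B} {δ : ℝ} (hδ : 0 < δ) (ha : 0 ≤ a)
    (hc : IsSelfAdjoint c) (hac : ‖a - c‖ ≤ δ) (hcb : c ≤ b) :
    ∃ g : B, CuntzBelow (cfcₙ (fun t : ℝ => max (t - 2 * δ) 0) a) (g * b * star g) := by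
  have hsa : IsSelfAdjoint a := .of_nonneg ha
  set φ : ℝ → ℝ := fun t => √(max (t - 2 * δ) 0 / max (t - δ) δ) with hφ
  have hpos : ∀ t : ℝ, 0 < max (t - δ) δ := fun t => lt_max_of_lt_right hδ
  have hφc : Continuous φ :=
    Real.continuous_sqrt.comp (Continuous.div (by fun_prop) (by fun_prop) fun t => (hpos t).ne')
  have hφ0 : φ 0 = 0 := by
    simp only [hφ]
    rw [max_eq_right (by linarith)]
    simp
  set g := cfcₙ φ a with hg
  have hgs : star g = g := IsSelfAdjoint.cfcₙ
  refine ⟨g, cuntzBelow_of_le (cfcₙ_nonneg fun t _ => le_max_right _ _) ?_⟩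
  have hcut : cfcₙ (fun t : ℝ => max (t - 2 * δ) 0) a = g * a * g - δ • (g * g) := by
    have h1 : g * a * g = cfcₙ (fun t => φ t * t * φ t) a := by
      rw [cfcₙ_mul (fun t => φ t * t) _ a (hφc.mul continuous_id).continuousOn (by simp)
        hφc.continuousOn hφ0, cfcₙ_mul φ (fun t => t) a hφc.continuousOn hφ0 continuousOn_id rfl,
        cfcₙ_id' ℝ a]
    have h2 : δ • (g * g) = cfcₙ (fun t => δ • (φ t * φ t)) a := by
      rw [cfcₙ_smul δ (fun t => φ t * φ t) a (hφc.mul hφc).continuousOn (by simp [hφ0]),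
        cfcₙ_mul _ _ a hφc.continuousOn hφ0 hφc.continuousOn hφ0]
    rw [h1, h2, ← cfcₙ_sub (fun t => φ t * t * φ t) (fun t => δ • (φ t * φ t)) a
      ((hφc.mul continuous_id).mul hφc).continuousOn (by simp)
      ((hφc.mul hφc).const_smul δ).continuousOn (by simp [hφ0])]
    refine cfcₙ_congr fun t _ => ?_
    have hsq : φ t * φ t = max (t - 2 * δ) 0 / max (t - δ) δ :=
      Real.mul_self_sqrt (div_nonneg (le_max_right _ _) (hpos t).le)
    have : φ t * t * φ t - δ • (φ t * φ t) = (t - δ) * (φ t * φ t) := by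
      simp only [smul_eq_mul]; ring
    rw [this, hsq]
    rcases le_total t (2 * δ) with h | h
    · rw [max_eq_right (by linarith : t - 2 * δ ≤ 0)]; simp
    · rw [max_eq_left (by linarith : δ ≤ t - δ)]
      have : t - δ ≠ 0 := by linarith
      field_simp
  rw [hcut, sub_le_iff_le_add]
  have h1 : g * (a - c) * star g ≤ δ • (g * star g) :=
    (CStarAlgebra.star_right_conjugate_le_norm_smul (hsa.sub hc)).trans
      (smul_le_smul_of_nonneg_right hac (mul_star_self_nonneg g))
  have h2 : g * c * star g ≤ g * b * star g := star_right_conjugate_le_conjugate hcb g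
  have h3 := add_le_add h2 h1
  rw [hgs] at h3 ⊢
  convert h3 using 1
  noncomm_ring

end CuntzComparison

section SimpleAlgebra

variable {A : Type*} [NonUnitalCStarAlgebra A]

/-- The closed two-sided ideal generated by the products `s * d * t`. -/
def idealSpan (d : A) : AddSubmonoid A :=
  (AddSubmonoid.closure (Set.range fun st : A × A => st.1 * d * st.2)).topologicalClosure

theorem isClosed_idealSpan (d : A) : IsClosed (idealSpan d : Set A) :=
  AddSubmonoid.isClosed_topologicalClosure _

theorem mul_mul_mem_idealSpan (d s t : A) : s * d * t ∈ idealSpan d :=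
  AddSubmonoid.le_topologicalClosure _ (AddSubmonoid.subset_closure ⟨(s, t), rfl⟩)

theorem idealSpan_le {d : A} {M : AddSubmonoid A} (hM : IsClosed (M : Set A))
    (h : ∀ s t : A, s * d * t ∈ M) : idealSpan d ≤ M :=
  AddSubmonoid.topologicalClosure_minimal _
    (AddSubmonoid.closure_le.2 (by rintro _ ⟨⟨s, t⟩, rfl⟩; exact h s t)) hM

theorem map_mem_idealSpan {d x : A} (φ : A →+ A) (hφ : Continuous φ)
    (h : ∀ s t : A, φ (s * d * t) ∈ idealSpan d) (hx : x ∈ idealSpan d) :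
    φ x ∈ idealSpan d :=
  idealSpan_le (M := (idealSpan d).comap φ) ((isClosed_idealSpan d).preimage hφ) h hx

theorem mul_left_mem_idealSpan {d x : A} (a : A) (hx : x ∈ idealSpan d) :
    a * x ∈ idealSpan d :=
  map_mem_idealSpan (AddMonoidHom.mulLeft a) (continuous_const_mul a)
    (fun s t => by
      simpa only [AddMonoidHom.coe_mulLeft, mul_assoc] using mul_mul_mem_idealSpan d (a * s) t) hx

theorem mul_right_mem_idealSpan {d x : A} (a : A) (hx : x ∈ idealSpan d) :
    x * a ∈ idealSpan d :=
  map_mem_idealSpan (AddMonoidHom.mulRight a) (continuous_mul_const a)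
    (fun s t => by
      simpa only [AddMonoidHom.mulRight_apply, mul_assoc] using
        mul_mul_mem_idealSpan d s (t * a)) hx

theorem smul_mem_idealSpan {d x : A} (c : ℂ) (hx : x ∈ idealSpan d) :
    c • x ∈ idealSpan d :=
  map_mem_idealSpan (DistribSMul.toAddMonoidHom A c) (continuous_const_smul c)
    (fun s t => by
      simpa only [DistribSMul.toAddMonoidHom_apply, smul_mul_assoc] using
        mul_mul_mem_idealSpan d (c • s) t) hx

theorem star_mem_idealSpan {d x : A} (hd : star d = d) (hx : x ∈ idealSpan d) :
    star x ∈ idealSpan d :=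
  map_mem_idealSpan (starAddEquiv : A ≃+ A).toAddMonoidHom continuous_star
    (fun s t => by
      simpa [hd, mul_assoc] using mul_mul_mem_idealSpan d (star t) (star s)) hx

theorem mul_self_ne_zero_of_star_eq {b : A} (hb : star b = b) (hb0 : b ≠ 0) : b * b ≠ 0 := by
  intro h
  apply hb0
  rw [← CStarRing.star_mul_self_eq_zero_iff, hb, h]

theorem mul_self_mul_ne_zero_of_star_eq {b : A} (hb : star b = b) (hb0 : b ≠ 0) :
    b * b * b ≠ 0 := by
  intro h
  refine mul_self_ne_zero_of_star_eq (b := b * b) (by simp [hb])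
    (mul_self_ne_zero_of_star_eq hb hb0) ?_
  rw [← mul_assoc, h, zero_mul]

/-- In a simple C*-algebra a closed star-invariant two-sided ideal with a nonzero element is
everything. -/
theorem IsSimpleCStar.mem_of_ideal (hA : IsSimpleCStar A) (M : AddSubmonoid A)
    (hM : IsClosed (M : Set A)) (hsmul : ∀ (c : ℂ), ∀ x ∈ M, c • x ∈ M)
    (hstar : ∀ x ∈ M, star x ∈ M) (hleft : ∀ a, ∀ x ∈ M, a * x ∈ M)
    (hright : ∀ a, ∀ x ∈ M, x * a ∈ M) {x : A} (hx : x ∈ M) (hx0 : x ≠ 0) (y : A) : y ∈ M := by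
  have key := hA.2
    { carrier :=
        { carrier := M
          add_mem' := M.add_mem
          zero_mem' := M.zero_mem
          mul_mem' := fun {a b} _ hb => hleft a b hb
          smul_mem' := fun c x hx => hsmul c x hx
          star_mem' := fun {a} ha => hstar a ha }
      isClosed := hM
      mul_mem_left := hleft
      mul_mem_right := hright }
  have key' : (M : Set A) = {0} ∨ (M : Set A) = Set.univ := key
  rcases key' with h | h
  · exact absurd (h ▸ hx : x ∈ ({0} : Set A)) hx0
  · exact (h ▸ Set.mem_univ y : y ∈ (M : Set A))

theorem IsSimpleCStar.mem_idealSpan (hA : IsSimpleCStar A) {d : A} (hd : star d = d)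
    (hd0 : d ≠ 0) (y : A) : y ∈ idealSpan d :=
  hA.mem_of_ideal (idealSpan d) (isClosed_idealSpan d) (fun c _ hx => smul_mem_idealSpan c hx)
    (fun _ hx => star_mem_idealSpan hd hx) (fun a _ hx => mul_left_mem_idealSpan a hx)
    (fun a _ hx => mul_right_mem_idealSpan a hx) (mul_mul_mem_idealSpan d d d)
    (mul_self_mul_ne_zero_of_star_eq hd hd0) y

/-- Simple C*-algebras are prime. -/
theorem IsSimpleCStar.eq_zero_or_eq_zero (hA : IsSimpleCStar A) {f g : A} (hf : star f = f)
    (h : ∀ z, f * z * g = 0) : f = 0 ∨ g = 0 := by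
  by_cases hf0 : f = 0
  · exact Or.inl hf0
  refine Or.inr ?_
  have hle : idealSpan f ≤
      (AddMonoidHom.mulRight g).ker.toAddSubmonoid := by
    refine idealSpan_le ?_ fun s t => ?_
    · exact isClosed_singleton.preimage (continuous_mul_const g)
    · simp [mul_assoc, h]
  have := hle (hA.mem_idealSpan hf hf0 (star g))
  rw [← CStarRing.star_mul_self_eq_zero_iff]
  simpa using this

theorem apply_eq_zero_of_cfcₙ_eq_zero {c : A} (hc : IsSelfAdjoint c) {φ : ℝ → ℝ} (hφ : Continuous φ)
    (hφ0 : φ 0 = 0) (h : cfcₙ φ c = 0) {l : ℝ} (hl : l ∈ quasispectrum ℝ c) : φ l = 0 := by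
  simpa [h] using norm_apply_le_norm_cfcₙ φ c hl hφ.continuousOn hφ0 hc

/-- If the hereditary subalgebra of `c` has no nilpotents of order two, then `c` is a multiple of a
projection. -/
theorem IsSimpleCStar.exists_mul_self_eq_smul (hA : IsSimpleCStar A) {c : A} (hc : IsSelfAdjoint c)
    (h : ∀ z, (c * z * c) * (c * z * c) = 0 → c * z * c = 0) : ∃ μ : ℝ, c * c = μ • c := by
  have key : ∀ l ∈ quasispectrum ℝ c, ∀ m ∈ quasispectrum ℝ c, l ≠ 0 → m ≠ 0 → l = m := by
    intro l hl m hm hl0 hm0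
    by_contra hlm
    have hr : 0 < |l - m| / 2 := by have := abs_pos.2 (sub_ne_zero.2 hlm); positivity
    obtain ⟨φ, hφ⟩ : ∃ φ : ℝ → ℝ → ℝ, φ = fun k t => t * max 0 (|l - m| / 2 - |t - k|) := ⟨_, rfl⟩
    have hφc : ∀ k, Continuous (φ k) := fun k => by subst hφ; fun_prop
    have hφ0 : ∀ k, φ k 0 = 0 := fun k => by simp [hφ]
    have hφφ : ∀ t, φ m t * φ l t = 0 := fun t => by
      rcases le_total (|l - m| / 2) (|t - m|) with h1 | h1
      · simp [hφ, max_eq_left (sub_nonpos.2 h1)]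
      · have h2 : |l - m| / 2 ≤ |t - l| := by
          have := abs_sub_le l t m
          rw [abs_sub_comm l t] at this
          linarith
        simp [hφ, max_eq_left (sub_nonpos.2 h2)]
    have hcφ : ∀ k, c * cfcₙ (φ k) c = cfcₙ (fun t => t * φ k t) c := fun k => by
      rw [cfcₙ_mul (fun t : ℝ => t) (φ k) c (by fun_prop) rfl (hφc k).continuousOn (hφ0 k),
        cfcₙ_id' ℝ c]
    have hcomm : ∀ k, cfcₙ (φ k) c * c = c * cfcₙ (φ k) c := fun k => by
      have := cfcₙ_commute_cfcₙ (φ k) (fun t : ℝ => t) c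
      rw [cfcₙ_id' ℝ c] at this
      exact this
    have hmul : cfcₙ (φ m) c * cfcₙ (φ l) c = 0 := by
      rw [← cfcₙ_mul (φ m) (φ l) c (hφc m).continuousOn (hφ0 m) (hφc l).continuousOn (hφ0 l)]
      simp only [hφφ]
      exact cfcₙ_const_zero ℝ c
    have hne : ∀ k ∈ quasispectrum ℝ c, k ≠ 0 → c * cfcₙ (φ k) c ≠ 0 := fun k hk hk0 h0 => by
      rw [hcφ k] at h0
      have := apply_eq_zero_of_cfcₙ_eq_zero hc (φ := fun t => t * φ k t)
        (continuous_id.mul (hφc k)) (by simp) h0 hk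
      simp [hφ, max_eq_right hr.le, hk0, hr.ne'] at this
    have hzero : ∀ z, (c * cfcₙ (φ l) c) * z * (c * cfcₙ (φ m) c) = 0 := fun z => by
      rw [← hcomm m]
      have := h (cfcₙ (φ l) c * z * cfcₙ (φ m) c) ?_
      · simpa only [mul_assoc] using this
      · calc _ = c * cfcₙ (φ l) c * z * (cfcₙ (φ m) c * c) * (c * cfcₙ (φ l) c) * z *
              cfcₙ (φ m) c * c := by noncomm_ring
          _ = c * cfcₙ (φ l) c * z * c * (cfcₙ (φ m) c * cfcₙ (φ l) c) * c * z *
              cfcₙ (φ m) c * c := by rw [hcomm m, ← hcomm l]; noncomm_ring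
          _ = 0 := by rw [hmul]; simp
    rcases hA.eq_zero_or_eq_zero (by
        rw [star_mul, (IsSelfAdjoint.cfcₙ : IsSelfAdjoint (cfcₙ (φ l) c)).star_eq, hc.star_eq,
          hcomm l]) hzero with h0 | h0
    · exact hne l hl hl0 h0
    · exact hne m hm hm0 h0
  obtain ⟨μ, hμ⟩ : ∃ μ : ℝ, ∀ t ∈ quasispectrum ℝ c, t * t = μ * t := by
    by_cases hex : ∃ l ∈ quasispectrum ℝ c, l ≠ 0
    · obtain ⟨l, hl, hl0⟩ := hex
      refine ⟨l, fun t ht => ?_⟩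
      by_cases ht0 : t = 0
      · simp [ht0]
      · rw [key t ht l hl ht0 hl0]
    · push Not at hex
      exact ⟨0, fun t ht => by simp [hex t ht]⟩
  refine ⟨μ, ?_⟩
  have h1 := cfcₙ_mul (fun t : ℝ => t) (fun t : ℝ => t) c
  have h2 := cfcₙ_const_mul μ (fun t : ℝ => t) c
  rw [cfcₙ_id' ℝ c] at h1 h2
  rw [← h1, ← h2]
  exact cfcₙ_congr hμ

/-- A minimal projection of a C*-algebra. -/
structure IsMinimalProjection {A : Type*} [NonUnitalCStarAlgebra A] (p : A) : Prop where
  ne_zero : p ≠ 0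
  star_eq : star p = p
  mul_self : p * p = p
  exists_smul : ∀ y, ∃ c : ℂ, p * y * p = c • p

/-- A nonzero selfadjoint element whose hereditary subalgebra has no nilpotents of order two is a
multiple of a minimal projection. -/
theorem IsSimpleCStar.exists_minimal_projection (hA : IsSimpleCStar A) {b : A}
    (hb : IsSelfAdjoint b) (hb0 : b ≠ 0)
    (h : ∀ z, (b * z * b) * (b * z * b) = 0 → b * z * b = 0) :
    ∃ p : A, IsMinimalProjection p := by
  obtain ⟨l, hl⟩ := hA.exists_mul_self_eq_smul hb h
  have hl0 : l ≠ 0 := by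
    rintro rfl
    exact mul_self_ne_zero_of_star_eq hb hb0 (by simpa using hl)
  obtain ⟨p, hp⟩ : ∃ p, p = l⁻¹ • b := ⟨_, rfl⟩
  have hbp : b = l • p := by rw [hp, smul_inv_smul₀ hl0]
  have hp0 : p ≠ 0 := by rintro rfl; simp [hb0] at hbp
  have hps : star p = p := by rw [hp, star_smul, hb.star_eq]; simp
  have hpp : p * p = p := by
    rw [hp, smul_mul_smul_comm, hl, smul_smul]
    congr 1
    field_simp
  have hnil : ∀ z, (p * z * p) * (p * z * p) = 0 → p * z * p = 0 := fun z hz => by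
    have hbz : b * z * b = (l * l) • (p * z * p) := by
      rw [hbp, smul_mul_assoc, smul_mul_smul_comm]
    have := h z (by rw [hbz, smul_mul_smul_comm, hz, smul_zero])
    rw [hbz] at this
    simpa [hl0] using this
  have hsa : ∀ y, star y = y → ∃ c : ℂ, p * y * p = c • p := fun y hy => by
    obtain ⟨c, hc⟩ : ∃ c, c = p * y * p := ⟨_, rfl⟩
    have hcs : star c = c := by simp [hc, hps, hy, mul_assoc]
    have hpc : p * c = c := by rw [hc, ← mul_assoc, ← mul_assoc, hpp]
    have hcp : c * p = c := by rw [hc, mul_assoc, hpp]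
    obtain ⟨μ, hμ⟩ := hA.exists_mul_self_eq_smul (c := c) hcs fun z hz => by
      have : c * z * c = p * (c * z * c) * p := by
        simp only [mul_assoc, hcp]
        simp only [← mul_assoc, hpc]
      rw [this] at hz ⊢
      exact hnil _ hz
    rw [← hc]
    by_cases hc0 : c = 0
    · exact ⟨0, by simp [hc0]⟩
    have hμ0 : μ ≠ 0 := by
      rintro rfl
      exact mul_self_ne_zero_of_star_eq hcs hc0 (by simpa using hμ)
    refine ⟨μ, ?_⟩
    have hzero : ∀ z, c * z * (μ • p - c) = 0 := fun z => by
      have : c * z * (μ • p - c) = p * (c * z * (μ • p - c)) * p := by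
        simp only [mul_sub, sub_mul, mul_smul_comm, smul_mul_assoc, mul_assoc, hcp, hpp]
        simp only [← mul_assoc, hpc]
      rw [this]
      refine hnil _ ?_
      rw [← this]
      have hk : (μ • p - c) * c = 0 := by rw [sub_mul, smul_mul_assoc, hpc, hμ, sub_self]
      calc _ = c * z * ((μ • p - c) * c) * z * (μ • p - c) := by simp only [mul_assoc]
        _ = 0 := by rw [hk]; simp
    rcases hA.eq_zero_or_eq_zero hcs hzero with h0 | h0
    · exact absurd h0 hc0
    · rw [Complex.coe_smul]
      exact (sub_eq_zero.1 h0).symm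
  refine ⟨p, hp0, hps, hpp, fun y => ?_⟩
  obtain ⟨c, hc⟩ := hsa (realPart y : A) (realPart y).2
  obtain ⟨d, hd⟩ := hsa (imaginaryPart y : A) (imaginaryPart y).2
  refine ⟨c + Complex.I * d, ?_⟩
  conv_lhs => rw [← realPart_add_I_smul_imaginaryPart y]
  rw [mul_add, add_mul, hc, mul_smul_comm, smul_mul_assoc, hd, smul_smul, add_smul]

end SimpleAlgebra

section Compact

variable {H : Type*} [NormedAddCommGroup H] [InnerProductSpace ℂ H] [CompleteSpace H]

/-- The compact operators are the closed span of the rank one operators. -/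
theorem IsCompactOperator.mem_of_rankOne_mem {M : AddSubmonoid (H →L[ℂ] H)}
    (hM : IsClosed (M : Set (H →L[ℂ] H))) (h : ∀ x y : H, InnerProductSpace.rankOne ℂ x y ∈ M)
    {T : H →L[ℂ] H} (hT : IsCompactOperator T) : T ∈ M := by
  refine hM.closure_subset (Metric.mem_closure_iff.2 fun ε hε => ?_)
  have hK := (hT.isCompact_closure_image_closedBall 1).totallyBounded
  obtain ⟨t, ht, hcov⟩ := Metric.totallyBounded_iff.1 hK (ε / 2) (by positivity)
  have : FiniteDimensional ℂ (Submodule.span ℂ t) := FiniteDimensional.span_of_finite ℂ ht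
  let V := Submodule.span ℂ t
  refine ⟨V.starProjection ∘L T, ?_, ?_⟩
  · have : V.starProjection ∘L T = ∑ i, InnerProductSpace.rankOne ℂ (stdOrthonormalBasis ℂ V i : H)
        (ContinuousLinearMap.adjoint T (stdOrthonormalBasis ℂ V i : H)) := by
      ext v
      simp [InnerProductSpace.rankOne_apply, ContinuousLinearMap.adjoint_inner_left,
        (stdOrthonormalBasis ℂ V).starProjection_eq_sum_rankOne]
    rw [this]
    exact M.sum_mem fun i _ => h _ _
  · rw [dist_eq_norm]
    refine lt_of_le_of_lt (ContinuousLinearMap.opNorm_le_of_unit_norm (C := ε / 2) (by positivity)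
      fun v hv => ?_) (half_lt_self hε)
    have hTv : T v ∈ ⋃ y ∈ t, Metric.ball y (ε / 2) :=
      hcov (subset_closure ⟨v, by simp [hv], rfl⟩)
    simp only [Set.mem_iUnion, Metric.mem_ball, dist_eq_norm] at hTv
    obtain ⟨y, hy, hyT⟩ := hTv
    have := Submodule.starProjection_minimal (U := V) (T v)
    simp only [sub_apply, ContinuousLinearMap.comp_apply]
    rw [this]
    exact (ciInf_le ⟨0, by rintro _ ⟨_, rfl⟩; positivity⟩
      (⟨y, Submodule.subset_span hy⟩ : V)).trans hyT.le

end Compact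

/-- The left ideal `A p`. -/
def leftIdealOf {A : Type*} [NonUnitalCStarAlgebra A] (p : A) : Submodule ℂ A where
  carrier := {x | x * p = x}
  add_mem' := fun {x y} hx hy => by
    exact (add_mul x y p).trans (congrArg₂ (· + ·) hx hy)
  zero_mem' := zero_mul p
  smul_mem' := fun c x hx => by
    exact (smul_mul_assoc c x p).trans (congrArg (c • ·) hx)

theorem isCompactOperator_rankOne {H : Type*} [NormedAddCommGroup H] [InnerProductSpace ℂ H]
    (x y : H) : IsCompactOperator (InnerProductSpace.rankOne ℂ x y) := by
  have h : IsCompactOperator (innerSL ℂ y) := isCompactOperator_of_locallyCompactSpace_dom _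
  exact h.clm_comp (ContinuousLinearMap.toSpanSingleton ℂ x)

section LeftIdeal

variable {A : Type*} [NonUnitalCStarAlgebra A] {p : A}

theorem mem_leftIdealOf {x : A} : x ∈ leftIdealOf p ↔ x * p = x := Iff.rfl

theorem isClosed_leftIdealOf : IsClosed (leftIdealOf p : Set A) :=
  isClosed_eq (continuous_mul_const p) continuous_id

theorem mul_mem_leftIdealOf (a : A) {x : A} (hx : x ∈ leftIdealOf p) : a * x ∈ leftIdealOf p := by
  rw [mem_leftIdealOf, mul_assoc, hx]

namespace IsMinimalProjection

theorem mul_mem (hp : IsMinimalProjection p) (a : A) : a * p ∈ leftIdealOf p := by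
  rw [mem_leftIdealOf, mul_assoc, hp.mul_self]

theorem norm_eq_one (hp : IsMinimalProjection p) : ‖p‖ = 1 := by
  have h := CStarRing.norm_star_mul_self (x := p)
  rw [hp.star_eq, hp.mul_self] at h
  have := norm_pos_iff.2 hp.ne_zero
  nlinarith

theorem exists_star_mul_eq_smul (hp : IsMinimalProjection p) (x y : leftIdealOf p) :
    ∃ c : ℂ, star (x : A) * (y : A) = c • p := by
  obtain ⟨c, hc⟩ := hp.exists_smul (star (x : A) * (y : A))
  refine ⟨c, hc ▸ ?_⟩
  have hx : p * star (x : A) = star (x : A) := by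
    simpa [hp.star_eq] using congrArg star (mem_leftIdealOf.1 x.2)
  rw [← mul_assoc, hx, mul_assoc, mem_leftIdealOf.1 y.2]

/-- The scalar `c` such that `star x * y = c • p`. -/
noncomputable def coeff (hp : IsMinimalProjection p) (x y : leftIdealOf p) : ℂ :=
  (hp.exists_star_mul_eq_smul x y).choose

theorem coeff_smul (hp : IsMinimalProjection p) (x y : leftIdealOf p) :
    hp.coeff x y • p = star (x : A) * (y : A) :=
  (hp.exists_star_mul_eq_smul x y).choose_spec.symm

theorem coeff_eq_of_smul (hp : IsMinimalProjection p) {x y : leftIdealOf p} {c : ℂ}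
    (h : star (x : A) * (y : A) = c • p) : hp.coeff x y = c :=
  smul_left_injective ℂ hp.ne_zero ((hp.coeff_smul x y).trans h)

theorem coeff_conj (hp : IsMinimalProjection p) (x y : leftIdealOf p) :
    (starRingEnd ℂ) (hp.coeff y x) = hp.coeff x y := by
  refine (hp.coeff_eq_of_smul ?_).symm
  have := congrArg star (hp.coeff_smul y x)
  simpa [hp.star_eq] using this.symm

theorem norm_sq_eq_re_coeff (hp : IsMinimalProjection p) (x : leftIdealOf p) :
    ‖x‖ ^ 2 = (hp.coeff x x).re := by
  obtain ⟨r, hr⟩ := Complex.conj_eq_iff_real.1 (hp.coeff_conj x x)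
  have hn : ‖x‖ ^ 2 = |r| := by
    have h := CStarRing.norm_star_mul_self (x := (x : A))
    rw [← hp.coeff_smul x x, norm_smul, hp.norm_eq_one, hr, Complex.norm_real] at h
    rw [sq, Submodule.coe_norm, ← h, mul_one, Real.norm_eq_abs]
  rw [hn, hr, Complex.ofReal_re]
  refine abs_of_nonneg (le_of_not_gt fun hneg => ?_)
  let := CStarAlgebra.spectralOrder A
  have := CStarAlgebra.spectralOrderedRing A
  have h1 : 0 ≤ r • p := by
    have := star_mul_self_nonneg (x : A)
    rwa [← hp.coeff_smul x x, hr, Complex.coe_smul] at this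
  have h2 : 0 ≤ p := by
    have := star_mul_self_nonneg p
    rwa [hp.star_eq, hp.mul_self] at this
  have h3 : r • p ≤ 0 := smul_nonpos_of_nonpos_of_nonneg hneg.le h2
  exact (smul_ne_zero hneg.ne hp.ne_zero) (le_antisymm h3 h1)

/-- The Hilbert space structure on the left ideal generated by a minimal projection. -/
@[reducible]
noncomputable def innerProductSpace (hp : IsMinimalProjection p) :
    InnerProductSpace ℂ (leftIdealOf p) where
  __ := Submodule.normedSpace (leftIdealOf p)
  inner := hp.coeff
  norm_sq_eq_re_inner := hp.norm_sq_eq_re_coeff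
  conj_inner_symm := hp.coeff_conj
  add_left x y z := hp.coeff_eq_of_smul (by
    rw [add_smul, hp.coeff_smul, hp.coeff_smul]; simp [add_mul])
  smul_left x y r := hp.coeff_eq_of_smul (by
    rw [mul_smul, hp.coeff_smul]; simp [smul_mul_assoc])

end IsMinimalProjection

/-- Left multiplication on a left ideal. -/
noncomputable def leftMulOn (p a : A) : leftIdealOf p →L[ℂ] leftIdealOf p :=
  ((ContinuousLinearMap.mul ℂ A a).comp (leftIdealOf p).subtypeL).codRestrict (leftIdealOf p)
    fun x => mul_mem_leftIdealOf a x.2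

@[simp]
theorem coe_leftMulOn (a : A) (x : leftIdealOf p) : (leftMulOn p a x : A) = a * x := rfl

end LeftIdeal

/-- A simple C*-algebra with a minimal projection is elementary. -/
theorem IsMinimalProjection.isElementaryCStar {A : Type} [NonUnitalCStarAlgebra A] {p : A}
    (hp : IsMinimalProjection p) (hA : IsSimpleCStar A) : IsElementaryCStar A := by
  let := hp.innerProductSpace
  have hcomplete : CompleteSpace (leftIdealOf p) := isClosed_leftIdealOf.completeSpace_coe
  let ψ : A →⋆ₙₐ[ℂ] (leftIdealOf p →L[ℂ] leftIdealOf p) :=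
    { toFun := leftMulOn p
      map_smul' := fun c a => by ext x; simp [smul_mul_assoc]
      map_zero' := by ext x; simp
      map_add' := fun a b => by ext x; simp [add_mul]
      map_mul' := fun a b => by ext x; simp [mul_assoc]
      map_star' := fun a => by
        rw [ContinuousLinearMap.star_eq_adjoint, ContinuousLinearMap.eq_adjoint_iff]
        intro x y
        exact hp.coeff_eq_of_smul (by
          change _ = hp.coeff x (leftMulOn p a y) • p
          rw [hp.coeff_smul]; simp [mul_assoc]) }
  have hψ : ∀ a x, (ψ a x : A) = a * x := fun a x => rfl
  have hinj : Function.Injective ψ := by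
    refine (injective_iff_map_eq_zero ψ).2 fun a ha => ?_
    have h0 : ∀ z, star a * a * z * p = 0 := fun z => by
      have := congrArg Subtype.val (DFunLike.congr_fun ha ⟨z * p, hp.mul_mem z⟩)
      rw [hψ] at this
      have h' : a * (z * p) = 0 := this
      rw [mul_assoc, mul_assoc, h', mul_zero]
    rcases hA.eq_zero_or_eq_zero (by simp) h0 with h | h
    · exact (CStarRing.star_mul_self_eq_zero_iff a).1 h
    · exact absurd h hp.ne_zero
  have hclosed : IsClosed (Set.range ψ) :=
    (NonUnitalStarAlgHom.isometry ψ hinj).isClosedEmbedding.isClosed_range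
  have hrank : ∀ s t : A, ψ (s * p * t) = InnerProductSpace.rankOne ℂ
      (⟨s * p, hp.mul_mem s⟩ : leftIdealOf p) ⟨star t * p, hp.mul_mem _⟩ := fun s t => by
    ext x
    rw [hψ, InnerProductSpace.rankOne_apply]
    change _ = hp.coeff _ x • (s * p)
    rw [← mul_smul_comm, hp.coeff_smul]
    simp [hp.star_eq, mul_assoc]
  refine ⟨leftIdealOf p, inferInstance, hp.innerProductSpace, hcomplete, ψ, hinj, ?_⟩
  refine Set.Subset.antisymm ?_ fun T hT => ?_
  · rintro _ ⟨a, rfl⟩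
    let C := (compactOperator (RingHom.id ℂ) (leftIdealOf p) (leftIdealOf p)).toAddSubmonoid
    refine idealSpan_le (M := C.comap (ψ : A →+ _)) ?_ (fun s t => ?_)
      (hA.mem_idealSpan hp.star_eq hp.ne_zero a)
    · exact isClosed_setOfPred_isCompactOperator.preimage
        (NonUnitalStarAlgHom.isometry ψ hinj).continuous
    · change IsCompactOperator (ψ (s * p * t))
      rw [hrank]
      exact isCompactOperator_rankOne _ _
  · refine IsCompactOperator.mem_of_rankOne_mem (M :=
      AddMonoidHom.mrange (ψ : A →+ (leftIdealOf p →L[ℂ] leftIdealOf p))) hclosed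
      (fun x y => ⟨x * p * star (y : A), ?_⟩) hT
    refine (hrank _ _).trans ?_
    simp only [star_star, mem_leftIdealOf.1 x.2, mem_leftIdealOf.1 y.2]

/-- In a simple nonelementary C*-algebra every nonzero hereditary subalgebra contains a nilpotent
of order two. -/
theorem IsSimpleCStar.exists_nilpotent {A : Type} [NonUnitalCStarAlgebra A] (hA : IsSimpleCStar A)
    (hne : ¬ IsElementaryCStar A) {b : A} (hb : star b = b) (hb0 : b ≠ 0) :
    ∃ y, b * y * b ≠ 0 ∧ (b * y * b) * (b * y * b) = 0 := by
  by_contra! h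
  obtain ⟨p, hp⟩ := hA.exists_minimal_projection hb hb0 fun z hz => by_contra fun h' => h z h' hz
  exact hne (hp.isElementaryCStar hA)

theorem matPad_single {A : Type*} [Zero A] {n : ℕ} (k i : Fin n) (y : A) :
    matPad (Matrix.single k i y) = Matrix.single k.castSucc i.castSucc y := by
  ext a b
  simp only [matPad, Matrix.of_apply, Matrix.single_apply, Fin.ext_iff, Fin.val_castSucc]
  split_ifs <;> first | rfl | omega

namespace IsCuntzSemigroupOf

section Stabilization

variable {A : Type uu} [NonUnitalCStarAlgebra A] {S : Type vv} [CuSemigroup S]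
  (hS : IsCuntzSemigroupOf A S)

/-- The elementary tensor `y ⊗ e_{k i}` in the stabilization. -/
def elt (k i : ℕ) (y : A) : hS.stab :=
  hS.matEmb (max k i + 1) (Matrix.single ⟨k, by omega⟩ ⟨i, by omega⟩ y)

theorem matEmb_single {n : ℕ} (k i : Fin n) (y : A) :
    hS.matEmb n (Matrix.single k i y) = hS.elt k i y := by
  obtain ⟨k, hk⟩ := k
  obtain ⟨i, hi⟩ := i
  have hn : max k i + 1 ≤ n := by omega
  induction n, hn using Nat.le_induction with
  | base => rfl
  | succ n hn ih =>
    rw [← ih (by omega) (by omega), ← hS.matEmb_compat n, matPad_single]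
    rfl

theorem elt_eq {k i n : ℕ} (hk : k < n) (hi : i < n) (y : A) :
    hS.elt k i y = hS.matEmb n (Matrix.single ⟨k, hk⟩ ⟨i, hi⟩ y) :=
  (hS.matEmb_single ⟨k, hk⟩ ⟨i, hi⟩ y).symm

theorem elt_add (k i : ℕ) (y z : A) : hS.elt k i (y + z) = hS.elt k i y + hS.elt k i z := by
  rw [elt, Matrix.single_add, map_add, elt, elt]

theorem elt_zero (k i : ℕ) : hS.elt k i 0 = 0 := by
  rw [elt, Matrix.single_zero, map_zero]

theorem elt_smul (k i : ℕ) (c : ℂ) (y : A) : hS.elt k i (c • y) = c • hS.elt k i y := by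
  rw [elt, ← Matrix.smul_single, map_smul, elt]

theorem star_elt (k i : ℕ) (y : A) : star (hS.elt k i y) = hS.elt i k (star y) := by
  rw [elt, ← map_star, Matrix.star_eq_conjTranspose, Matrix.conjTranspose_single, matEmb_single]

theorem elt_mul_elt (k i j : ℕ) (y z : A) :
    hS.elt k i y * hS.elt i j z = hS.elt k j (y * z) := by
  rw [hS.elt_eq (n := k + i + j + 1) (by omega) (by omega), hS.elt_eq (k := i)
    (n := k + i + j + 1) (by omega) (by omega), ← map_mul, Matrix.single_mul_single_same,
    matEmb_single]

theorem elt_mul_elt_of_ne (k j : ℕ) {i i' : ℕ} (h : i ≠ i') (y z : A) :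
    hS.elt k i y * hS.elt i' j z = 0 := by
  rw [hS.elt_eq (n := k + i + i' + j + 1) (by omega) (by omega), hS.elt_eq (k := i')
    (n := k + i + i' + j + 1) (by omega) (by omega), ← map_mul,
    Matrix.single_mul_single_of_ne _ _ _ _ (by simpa using h), map_zero]

theorem elt_injective (k i : ℕ) : Function.Injective (hS.elt k i) := by
  intro y z h
  have := hS.matEmb_injective _ h
  simpa using congrFun (congrFun this ⟨k, by omega⟩) ⟨i, by omega⟩

/-- The diagonal corner embeddings of `A` into its stabilization. -/
noncomputable def diagHom (i : ℕ) : A →⋆ₙₐ[ℂ] hS.stab where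
  toFun := hS.elt i i
  map_smul' := hS.elt_smul i i
  map_zero' := hS.elt_zero i i
  map_add' := hS.elt_add i i
  map_mul' y z := (hS.elt_mul_elt i i i y z).symm
  map_star' y := (hS.star_elt i i y).symm

theorem norm_elt (k i : ℕ) (y : A) : ‖hS.elt k i y‖ = ‖y‖ := by
  have h1 : ‖hS.diagHom i (star y * y)‖ = ‖star y * y‖ :=
    (NonUnitalStarAlgHom.isometry (hS.diagHom i) (hS.elt_injective i i)).norm_map_of_map_zero
      (map_zero _) _
  change ‖hS.elt i i (star y * y)‖ = _ at h1
  rw [← hS.elt_mul_elt i k i, ← hS.star_elt, CStarRing.norm_star_mul_self,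
    CStarRing.norm_star_mul_self] at h1
  exact (mul_self_inj (norm_nonneg _) (norm_nonneg _)).1 h1

/-- The entry embeddings as additive homomorphisms. -/
noncomputable def eltHom (k i : ℕ) : A →+ hS.stab where
  toFun := hS.elt k i
  map_zero' := hS.elt_zero k i
  map_add' := hS.elt_add k i

theorem continuous_elt (k i : ℕ) : Continuous (hS.elt k i) :=
  AddMonoidHomClass.continuous_of_bound (hS.eltHom k i) 1 fun y => by
    rw [one_mul]; exact (hS.norm_elt k i y).le

theorem mem_of_elt_mem {M : AddSubmonoid hS.stab} (hM : IsClosed (M : Set hS.stab))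
    (h : ∀ k i y, hS.elt k i y ∈ M) (a : hS.stab) : a ∈ M := by
  refine hM.closure_subset_iff.2 ?_ (hS.matEmb_dense a)
  refine Set.iUnion_subset fun n => ?_
  rintro _ ⟨m, rfl⟩
  rw [Matrix.matrix_eq_sum_single m, map_sum]
  refine M.sum_mem fun k _ => ?_
  rw [map_sum]
  refine M.sum_mem fun i _ => ?_
  rw [matEmb_single]
  exact h _ _ _

theorem exists_corner_eq (i : ℕ) (x : A) (a : hS.stab) :
    ∃ b, hS.elt 0 0 b = hS.elt 0 i x * a * star (hS.elt 0 i x) := by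
  let φ : hS.stab →+ hS.stab :=
    (AddMonoidHom.mulRight (star (hS.elt 0 i x))).comp (AddMonoidHom.mulLeft (hS.elt 0 i x))
  refine hS.mem_of_elt_mem (M := (AddMonoidHom.mrange (hS.diagHom 0 : A →+ hS.stab)).comap φ)
    ?_ (fun k j y => ?_) a
  · have hφ : Continuous φ := (continuous_const_mul (hS.elt 0 i x)).mul_const _
    have hr : IsClosed (Set.range (hS.diagHom 0)) := (NonUnitalStarAlgHom.isometry (hS.diagHom 0)
      (hS.elt_injective 0 0)).isClosedEmbedding.isClosed_range
    exact hr.preimage hφ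
  · change ∃ b, hS.elt 0 0 b = hS.elt 0 i x * hS.elt k j y * star (hS.elt 0 i x)
    rw [star_elt]
    by_cases hk : i = k
    · subst hk
      rw [elt_mul_elt]
      by_cases hj : j = i
      · subst hj
        exact ⟨_, (hS.elt_mul_elt _ _ _ _ _).symm⟩
      · exact ⟨0, by rw [hS.elt_mul_elt_of_ne _ _ hj, elt_zero]⟩
    · exact ⟨0, by rw [hS.elt_mul_elt_of_ne _ _ hk, zero_mul, elt_zero]⟩

/-- Every nonzero positive element of the stabilization compresses to a nonzero element of `A`. -/
theorem exists_corner {s : hS.stab} (hs : star s = s) (hs0 : s * s ≠ 0) :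
    ∃ (u : hS.stab) (b : A), b ≠ 0 ∧ star b = b ∧ hS.elt 0 0 b = u * (s * s) * star u := by
  by_contra! h
  have h1 : ∀ i x, hS.elt 0 i x * s = 0 := fun i x => by
    obtain ⟨b, hb⟩ := hS.exists_corner_eq i x (s * s)
    have hb0 : b = 0 := by
      by_contra hb0
      refine h _ b hb0 (hS.elt_injective 0 0 ?_) hb
      rw [← star_elt, hb]
      simp [hs, mul_assoc]
    rw [← CStarRing.mul_star_self_eq_zero_iff, star_mul, hs, ← mul_assoc, mul_assoc _ s s, ← hb, hb0,
      elt_zero]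
  have h2 : ∀ k i x, hS.elt k i x * s = 0 := fun k i x => by
    rw [← CStarRing.star_mul_self_eq_zero_iff, star_mul, star_elt, mul_assoc,
      ← mul_assoc _ (hS.elt k i x), elt_mul_elt, ← hS.elt_mul_elt i 0 i, mul_assoc, h1]
    simp
  exact hs0 (hS.mem_of_elt_mem (M := AddMonoidHom.mker (AddMonoidHom.mulRight s))
    (isClosed_singleton.preimage (continuous_mul_const s)) h2 s)

/-- The stabilization of a simple C*-algebra has no nontrivial closed ideals. -/
theorem mem_idealSpan (hA : IsSimpleCStar A) {s : hS.stab} (hs : star s = s) (hs0 : s * s ≠ 0)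
    (a : hS.stab) : a ∈ idealSpan (s * s) := by
  obtain ⟨u, b, hb0, hb, hub⟩ := hS.exists_corner hs hs0
  refine hS.mem_of_elt_mem (isClosed_idealSpan _) (fun k i y => ?_) a
  let K : AddSubmonoid A := ⨅ (k : ℕ) (i : ℕ), (idealSpan (s * s)).comap (hS.eltHom k i)
  have hK : ∀ y, y ∈ K ↔ ∀ k i, hS.elt k i y ∈ idealSpan (s * s) := fun y => by
    simp [K, AddSubmonoid.mem_iInf, eltHom]
  have hclosed : IsClosed (K : Set A) := by
    have : (K : Set A) = ⋂ (k : ℕ) (i : ℕ), hS.elt k i ⁻¹' (idealSpan (s * s) : Set hS.stab) := by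
      ext y; simpa using hK y
    rw [this]
    exact isClosed_iInter fun k => isClosed_iInter fun i =>
      (isClosed_idealSpan _).preimage (hS.continuous_elt k i)
  refine (hK y).1 (hA.mem_of_ideal K hclosed (fun c y hy => ?_) (fun y hy => ?_)
    (fun z y hy => ?_) (fun z y hy => ?_) (x := b * b * b) ?_
    (mul_self_mul_ne_zero_of_star_eq hb hb0) y) k i
  all_goals rw [hK] at *; intro k i
  · rw [elt_smul]; exact smul_mem_idealSpan c (hy k i)
  · rw [← star_elt]; exact star_mem_idealSpan (by simp [hs]) (hy i k)
  · rw [← hS.elt_mul_elt k k i]; exact mul_left_mem_idealSpan _ (hy k i)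
  · rw [← hS.elt_mul_elt k i i]; exact mul_right_mem_idealSpan _ (hy k i)
  · rw [← hS.elt_mul_elt k 0 i, ← hS.elt_mul_elt k 0 0, hub]
    exact mul_right_mem_idealSpan _ (mul_left_mem_idealSpan _ (mul_mul_mem_idealSpan _ _ _))

end Stabilization

end IsCuntzSemigroupOf

theorem CuntzBelow.smul {B : Type*} [NonUnitalCStarAlgebra B] {a b : B} {c : ℝ}
    (h : CuntzBelow a b) (hc : 0 ≤ c) : CuntzBelow (c • a) b := by
  obtain ⟨r, hr⟩ := h
  refine ⟨fun n => √c • r n, ?_⟩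
  convert hr.const_smul c using 2 with n
  rw [star_smul, star_trivial, smul_mul_assoc, smul_mul_smul_comm, Real.mul_self_sqrt hc]

instance CuSemigroup.isOrderedAddMonoid {S : Type*} [CuSemigroup S] : IsOrderedAddMonoid S where
  add_le_add_left a b h c := by
    rw [add_comm a, add_comm b]
    exact CuSemigroup.add_le_add' a b h c

namespace IsCuntzSemigroupOf

section Comparison

variable {A : Type uu} [NonUnitalCStarAlgebra A] {S : Type vv} [CuSemigroup S]
  (hS : IsCuntzSemigroupOf A S) [PartialOrder hS.stab] [StarOrderedRing hS.stab]

theorem cls_le_cls {a b : hS.stab} (ha : 0 ≤ a) (hb : 0 ≤ b) (h : CuntzBelow a b) :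
    hS.cls a ≤ hS.cls b :=
  (hS.cls_le_iff a b (cstarNonneg_iff_nonneg.2 ha) (cstarNonneg_iff_nonneg.2 hb)).2 h

theorem cls_le_cls_of_le {a b : hS.stab} (ha : 0 ≤ a) (hab : a ≤ b) : hS.cls a ≤ hS.cls b :=
  hS.cls_le_cls ha (ha.trans hab) (cuntzBelow_of_le ha hab)

theorem cls_conj_le (r : hS.stab) {b : hS.stab} (hb : 0 ≤ b) :
    hS.cls (r * b * star r) ≤ hS.cls b :=
  hS.cls_le_cls (star_right_conjugate_nonneg hb r) hb (cuntzBelow_conj r b)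

theorem exists_cls_eq (x : S) : ∃ a : hS.stab, 0 ≤ a ∧ hS.cls a = x := by
  obtain ⟨a, ha, rfl⟩ := hS.cls_surj x
  exact ⟨a, cstarNonneg_iff_nonneg.1 ha, rfl⟩

theorem cls_add_of_mul_eq_zero {a b : hS.stab} (ha : 0 ≤ a) (hb : 0 ≤ b) (hab : a * b = 0) :
    hS.cls (a + b) = hS.cls a + hS.cls b :=
  hS.cls_add_orth a b (cstarNonneg_iff_nonneg.2 ha) (cstarNonneg_iff_nonneg.2 hb) hab

theorem cls_eq_zero_iff {a : hS.stab} (ha : 0 ≤ a) : hS.cls a = 0 ↔ a = 0 := by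
  refine ⟨fun h => eq_zero_of_cuntzBelow_zero ?_, fun h => by rw [h, hS.cls_zero]⟩
  rw [← hS.cls_zero] at h
  exact (hS.cls_le_iff a 0 (cstarNonneg_iff_nonneg.2 ha) (cstarNonneg_iff_nonneg.2 le_rfl)).1 h.le

theorem cls_add_le {a b : hS.stab} (ha : 0 ≤ a) (hb : 0 ≤ b) :
    hS.cls (a + b) ≤ hS.cls a + hS.cls b := by
  obtain ⟨a', b', ha', hb', hab, hca, hcb⟩ :=
    hS.exists_orth a b (cstarNonneg_iff_nonneg.2 ha) (cstarNonneg_iff_nonneg.2 hb)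
  have hxa := (hS.cls_le_iff _ _ (cstarNonneg_iff_nonneg.2 ha) ha').1 hca.ge
  have hxb := (hS.cls_le_iff _ _ (cstarNonneg_iff_nonneg.2 hb) hb').1 hcb.ge
  rw [← hca, ← hcb, ← hS.cls_add_orth a' b' ha' hb' hab]
  rw [cstarNonneg_iff_nonneg] at ha' hb'
  exact hS.cls_le_cls (add_nonneg ha hb) (add_nonneg ha' hb')
    (cuntzBelow_add_of_orthogonal ha' hb' hab hxa hxb)

theorem exists_add_star_le {b z : hS.stab} (hb : 0 ≤ b)
    (hz : z ∈ AddSubmonoid.closure (Set.range fun st : hS.stab × hS.stab => st.1 * b * st.2)) :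
    ∃ (N : ℕ) (b' : hS.stab), 0 ≤ b' ∧ z + star z ≤ b' ∧ hS.cls b' ≤ N • hS.cls b := by
  induction hz using AddSubmonoid.closure_induction with
  | mem _ h =>
    obtain ⟨⟨s, t⟩, rfl⟩ := h
    have h1 := star_right_conjugate_nonneg hb s
    have h2 := star_right_conjugate_nonneg hb (star t)
    refine ⟨2, s * b * star s + star t * b * star (star t), add_nonneg h1 h2, ?_, ?_⟩
    · have h3 := star_right_conjugate_nonneg hb (s - star t)
      rw [← sub_nonneg]
      convert h3 using 1
      have hbs : star b = b := (IsSelfAdjoint.of_nonneg hb).star_eq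
      simp only [star_mul, star_sub, star_star, hbs]
      noncomm_ring
    · rw [two_nsmul]
      exact (hS.cls_add_le h1 h2).trans
        (add_le_add (hS.cls_conj_le s hb) (hS.cls_conj_le (star t) hb))
  | zero => exact ⟨0, 0, le_rfl, by simp, by simp [hS.cls_zero]⟩
  | add x y _ _ ihx ihy =>
    obtain ⟨M, b₁, hb₁, hx, hM⟩ := ihx
    obtain ⟨N, b₂, hb₂, hy, hN⟩ := ihy
    refine ⟨M + N, b₁ + b₂, add_nonneg hb₁ hb₂, ?_, ?_⟩
    · rw [star_add, add_add_add_comm]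
      exact add_le_add hx hy
    · rw [add_nsmul]
      exact (hS.cls_add_le hb₁ hb₂).trans (add_le_add hM hN)

end Comparison

section Semigroup

variable {A : Type uu} [NonUnitalCStarAlgebra A] {S : Type vv} [CuSemigroup S]

/-- Every element way below another one is bounded by a multiple of any nonzero element. -/
theorem exists_le_nsmul (hS : IsCuntzSemigroupOf A S) (hA : IsSimpleCStar A) {d x' x : S}
    (hd : d ≠ 0) (hx : WayBelow x' x) : ∃ N : ℕ, x' ≤ N • d := by
  let := CStarAlgebra.spectralOrder hS.stab
  have := CStarAlgebra.spectralOrderedRing hS.stab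
  obtain ⟨b, hb, rfl⟩ := hS.exists_cls_eq d
  obtain ⟨a, ha, rfl⟩ := hS.exists_cls_eq x
  obtain ⟨s, -, hs, hsb, -⟩ := exists_sqrt_approxUnit hb
  have hb0 : s * s ≠ 0 := fun h => hd ((hS.cls_eq_zero_iff hb).2 (hsb ▸ h))
  obtain ⟨ε, hε, hxε⟩ := (hS.waybelow_iff _ a (cstarNonneg_iff_nonneg.2 ha)).1 hx
  obtain ⟨z, hz, haz⟩ := Metric.mem_closure_iff.1
    (hS.mem_idealSpan hA hs hb0 a) (ε / 2) (half_pos hε)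
  rw [hsb] at hz
  obtain ⟨N, b', hb', hzb, hN⟩ := hS.exists_add_star_le hb hz
  have has : star a = a := (IsSelfAdjoint.of_nonneg ha).star_eq
  obtain ⟨g, hg⟩ := exists_cutDown_cuntzBelow_conj (half_pos hε) ha
    (c := (1 / 2 : ℝ) • (z + star z)) (b := (1 / 2 : ℝ) • b')
    (by rw [IsSelfAdjoint, star_smul, star_add, star_star, add_comm]; simp)
    (by
      have h1 : a - (1 / 2 : ℝ) • (z + star z) = (1 / 2 : ℝ) • ((a - z) + star (a - z)) := by
        rw [star_sub, has]
        module
      rw [h1, norm_smul, Real.norm_of_nonneg (by norm_num)]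
      have h2 := norm_add_le (a - z) (star (a - z))
      rw [norm_star] at h2
      rw [dist_eq_norm] at haz
      linarith)
    (smul_le_smul_of_nonneg_left hzb (by norm_num))
  have hhalf : 0 ≤ (1 / 2 : ℝ) • b' := smul_nonneg (by norm_num) hb'
  have hhalf' : (1 / 2 : ℝ) • b' ≤ b' := by
    conv_rhs => rw [← one_smul ℝ b']
    exact smul_le_smul_of_nonneg_right (by norm_num) hb'
  rw [mul_div_cancel₀ ε two_ne_zero] at hg
  refine ⟨N, hxε.trans ((hS.cls_le_cls (cfcₙ_nonneg fun t _ => le_max_right _ _)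
    (star_right_conjugate_nonneg hhalf g) hg).trans ((hS.cls_conj_le g hhalf).trans
    ((hS.cls_le_cls_of_le hhalf hhalf').trans hN)))⟩

end Semigroup

/-- In the Cuntz semigroup of a simple nonelementary C*-algebra, every nonzero element dominates
twice a nonzero element. -/
theorem exists_add_self_le {A : Type} [NonUnitalCStarAlgebra A] {S : Type vv} [CuSemigroup S]
    (hS : IsCuntzSemigroupOf A S) (hA : IsSimpleCStar A) (hne : ¬ IsElementaryCStar A) {x : S}
    (hx : x ≠ 0) : ∃ d : S, d ≠ 0 ∧ d + d ≤ x := by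
  let := CStarAlgebra.spectralOrder hS.stab
  have := CStarAlgebra.spectralOrderedRing hS.stab
  obtain ⟨a, ha, rfl⟩ := hS.exists_cls_eq x
  obtain ⟨s, -, hs, hsa, -⟩ := exists_sqrt_approxUnit ha
  have ha0 : s * s ≠ 0 := fun h => hx ((hS.cls_eq_zero_iff ha).2 (hsa ▸ h))
  obtain ⟨u, b, hb0, hb, hub⟩ := hS.exists_corner hs ha0
  obtain ⟨y, hw0, hww⟩ := hA.exists_nilpotent hne hb hb0
  obtain ⟨w, hw⟩ : ∃ w, w = hS.elt 0 0 (b * y * b) := ⟨_, rfl⟩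
  obtain ⟨v, hv⟩ : ∃ v, v = u * s := ⟨_, rfl⟩
  have hvv : v * star v = u * a * star u := by
    rw [hv, star_mul, hs, ← hsa]; simp only [mul_assoc]
  have hbv : hS.elt 0 0 b = v * star v := by rw [hub, hvv, hsa]
  have hwv : ∃ q, w = v * q * star v := ⟨star v * hS.elt 0 0 y * v, by
    rw [hw, ← hS.elt_mul_elt 0 0 0, ← hS.elt_mul_elt 0 0 0, hbv]; simp only [mul_assoc]⟩
  obtain ⟨q, hq⟩ := hwv
  have hw0' : w ≠ 0 := fun h => hw0 (hS.elt_injective 0 0 (by rw [← hw, h, hS.elt_zero]))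
  have hww' : w * w = 0 := by rw [hw, hS.elt_mul_elt, hww, hS.elt_zero]
  have h1 := star_mul_self_nonneg w
  have h2 := mul_star_self_nonneg w
  have heq : hS.cls (star w * w) = hS.cls (w * star w) := le_antisymm
    (hS.cls_le_cls h1 h2 (cuntzBelow_star_mul_self w))
    (hS.cls_le_cls h2 h1 (by simpa using cuntzBelow_star_mul_self (star w)))
  refine ⟨hS.cls (star w * w), fun h => ?_, ?_⟩
  · exact hw0' ((CStarRing.star_mul_self_eq_zero_iff w).1 ((hS.cls_eq_zero_iff h1).1 h))
  obtain ⟨Q, hQ⟩ : ∃ Q, Q = star q * (star v * v) * q + q * (star v * v) * star q := ⟨_, rfl⟩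
  have hQ' : star w * w + w * star w = v * Q * star v := by
    rw [hQ, hq]; simp only [star_mul, star_star]; noncomm_ring
  calc hS.cls (star w * w) + hS.cls (star w * w)
      = hS.cls (star w * w + w * star w) := by
        rw [hS.cls_add_of_mul_eq_zero h1 h2, ← heq]
        rw [mul_assoc, ← mul_assoc w w, hww']; simp
    _ ≤ hS.cls (v * star v) := by
        rw [hQ']
        have hQs : 0 ≤ Q := by
          rw [hQ]
          exact add_nonneg (star_left_conjugate_nonneg (star_mul_self_nonneg v) q)
            (star_right_conjugate_nonneg (star_mul_self_nonneg v) q)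
        refine (hS.cls_le_cls_of_le (star_right_conjugate_nonneg hQs v)
          (CStarAlgebra.star_right_conjugate_le_norm_smul (IsSelfAdjoint.of_nonneg hQs))).trans ?_
        exact hS.cls_le_cls (smul_nonneg (norm_nonneg _) (mul_star_self_nonneg v))
          (mul_star_self_nonneg v)
          ((cuntzBelow_of_le (mul_star_self_nonneg v) le_rfl).smul (norm_nonneg _))
    _ ≤ hS.cls a := hvv ▸ hS.cls_conj_le u ha

end IsCuntzSemigroupOf

section WeakDivisibility

variable {S : Type*} [CuSemigroup S]

theorem WayBelow.le {x y : S} (h : WayBelow x y) : x ≤ y := by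
  obtain ⟨_, hn⟩ := h (fun _ => y) monotone_const y (by simp) le_rfl
  exact hn

theorem wayBelow_zero (x : S) : WayBelow 0 x := fun _ _ _ _ _ => ⟨0, CuSemigroup.zero_le' _⟩

theorem exists_wdiv_lt_top {x d : S} {n : ℕ} (h : x ≤ n • d) (hd : d + d ≤ x) :
    ∃ m : ℕ, 1 ≤ m ∧ CuDiv.wdiv (2 * m) x < ⊤ := by
  refine ⟨1, le_rfl, ?_⟩
  have hmem : ((n + 1 : ℕ) : ℕ∞) ∈
      {N : ℕ∞ | ∃ n : ℕ, 1 ≤ n ∧ N = n ∧ CuDiv.IsWeaklyDivisible (2 * 1) n x} := by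
    refine ⟨n + 1, by omega, rfl, fun x' hx' => ⟨fun _ => d, ?_, fun _ => ?_⟩⟩
    · rw [Finset.sum_const, Finset.card_univ, Fintype.card_fin, add_nsmul, one_nsmul]
      exact (hx'.le.trans h).trans (le_add_of_nonneg_right (CuSemigroup.zero_le' d))
    · rw [mul_one, two_nsmul]
      exact hd
  exact (sInf_le hmem).trans_lt (ENat.natCast_lt_top _)

theorem exists_wdiv_zero_lt_top : ∃ m : ℕ, 1 ≤ m ∧ CuDiv.wdiv (2 * m) (0 : S) < ⊤ :=
  exists_wdiv_lt_top (d := 0) (n := 0) (by simp) (by simp)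

/-- An interleaving of a sequence `f` by elements with a property `P` yields an increasing sequence
with property `P` and the same supremum. -/
theorem exists_monotone_isLUB_of_interleaving {α : Type*} [PartialOrder α] {P : α → Prop}
    {f : ℕ → α} (hf : Monotone f) {x : α} (hx : IsLUB (Set.range f) x)
    (h : ∀ k, ∃ y l, k < l ∧ f k ≤ y ∧ y ≤ f l ∧ P y) :
    ∃ g : ℕ → α, Monotone g ∧ (∀ k, P (g k)) ∧ IsLUB (Set.range g) x := by
  choose Y L hL hfY hYf hP using h
  have hidx : StrictMono fun n => L^[n] 0 := strictMono_nat_of_lt_succ fun n => by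
    rw [Function.iterate_succ_apply']
    exact hL _
  refine ⟨fun n => Y (L^[n] 0), monotone_nat_of_le_succ fun n => ?_, fun n => hP _, ?_, ?_⟩
  · rw [Function.iterate_succ_apply']
    exact (hYf _).trans (hfY _)
  · rintro _ ⟨n, rfl⟩
    exact (hYf _).trans (hx.1 ⟨_, rfl⟩)
  · intro u hu
    refine hx.2 ?_
    rintro _ ⟨m, rfl⟩
    exact ((hf (hidx.id_le m)).trans (hfY _)).trans (hu ⟨m, rfl⟩)

end WeakDivisibility

namespace IsCuntzSemigroupOf

theorem exists_isLUB_wdiv_lt_top {A : Type} [NonUnitalCStarAlgebra A] {S : Type vv}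
    [CuSemigroup S] (hS : IsCuntzSemigroupOf A S) (hA : IsSimpleCStar A)
    (hne : ¬ IsElementaryCStar A) (x : S) : ∃ f : ℕ → S, Monotone f ∧
      (∀ k, ∃ m : ℕ, 1 ≤ m ∧ CuDiv.wdiv (2 * m) (f k) < ⊤) ∧ IsLUB (Set.range f) x := by
  obtain ⟨f, hf, hwb, hx⟩ := CuSemigroup.exists_waybelow_seq x
  by_cases hcase : ∃ k, ∀ l, k < l → f l ≤ f (k + 1)
  · obtain ⟨k, hk⟩ := hcase
    have hxk : x = f (k + 1) := by
      refine le_antisymm (hx.2 ?_) (hx.1 ⟨_, rfl⟩)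
      rintro _ ⟨l, rfl⟩
      rcases lt_or_ge k l with h | h
      · exact hk l h
      · exact hf (by omega)
    have hxx : WayBelow x x := by
      have h1 := hwb (k + 1)
      rwa [← le_antisymm (hf (by omega)) (hk (k + 1 + 1) (by omega)), ← hxk] at h1
    refine ⟨fun _ => x, monotone_const, fun _ => ?_, by simp⟩
    by_cases hx0 : x = 0
    · rw [hx0]
      exact exists_wdiv_zero_lt_top
    · obtain ⟨d, hd0, hd⟩ := hS.exists_add_self_le hA hne hx0
      obtain ⟨N, hN⟩ := hS.exists_le_nsmul hA hd0 hxx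
      exact exists_wdiv_lt_top hN hd
  · push Not at hcase
    refine exists_monotone_isLUB_of_interleaving
      (P := fun y => ∃ m : ℕ, 1 ≤ m ∧ CuDiv.wdiv (2 * m) y < ⊤) hf hx fun k => ?_
    obtain ⟨l, hkl, hl⟩ := hcase k
    obtain ⟨c, -, hc, hlc⟩ := CuSemigroup.almost_algebraic (f k) (f (k + 1)) 0 0 (f l) (hwb k)
      (wayBelow_zero 0) (by rw [add_zero]; exact hf hkl)
    have hc0 : c ≠ 0 := by
      rintro rfl
      exact hl (by simpa using hlc)
    obtain ⟨d, hd0, hd⟩ := hS.exists_add_self_le hA hne hc0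
    obtain ⟨N, hN⟩ := hS.exists_le_nsmul hA hd0 (hwb k)
    refine ⟨f k + (d + d), l, hkl, ?_, ?_, exists_wdiv_lt_top (d := d) (n := N + 2) ?_ ?_⟩
    · exact le_add_of_nonneg_right (CuSemigroup.zero_le' _)
    · exact (add_le_add le_rfl hd).trans hc
    · rw [add_nsmul, two_nsmul]
      exact add_le_add hN le_rfl
    · exact le_add_of_nonneg_left (CuSemigroup.zero_le' _)

section InfiniteProjection

variable {A : Type uu} [NonUnitalCStarAlgebra A] {S : Type vv} [CuSemigroup S]

theorem wayBelow_cls_self (hS : IsCuntzSemigroupOf A S) {p : hS.stab} (hps : star p = p)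
    (hpp : p * p = p) : WayBelow (hS.cls p) (hS.cls p) := by
  let := CStarAlgebra.spectralOrder hS.stab
  have := CStarAlgebra.spectralOrderedRing hS.stab
  have hp0 : 0 ≤ p := by
    have := star_mul_self_nonneg p
    rwa [hps, hpp] at this
  have hsp : ∀ t ∈ quasispectrum ℝ p, t * t - t = 0 := fun t ht => by
    refine apply_eq_zero_of_cfcₙ_eq_zero (φ := fun t => t * t - t) hps (by fun_prop) (by simp) ?_ ht
    rw [cfcₙ_sub (fun t : ℝ => t * t) (fun t : ℝ => t) p,
      cfcₙ_mul (fun t : ℝ => t) (fun t : ℝ => t) p, cfcₙ_id' ℝ p, hpp, sub_self]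
  have hcut : cfcₙ (fun t : ℝ => max (t - 1 / 2) 0) p = (1 / 2 : ℝ) • p := by
    have h := cfcₙ_const_mul (1 / 2 : ℝ) (fun t : ℝ => t) p
    rw [cfcₙ_id' ℝ p] at h
    rw [← h]
    refine cfcₙ_congr fun t ht => ?_
    have ht' : t * (t - 1) = 0 := by linarith [hsp t ht]
    rcases mul_eq_zero.1 ht' with h0 | h1
    · norm_num [h0]
    · rw [sub_eq_zero.1 h1]
      norm_num
  refine (hS.waybelow_iff _ p (cstarNonneg_iff_nonneg.2 hp0)).2 ⟨1 / 2, by norm_num, ?_⟩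
  rw [hcut]
  have hhalf : 0 ≤ (1 / 2 : ℝ) • p := smul_nonneg (by norm_num) hp0
  refine hS.cls_le_cls hp0 hhalf ?_
  have h := (cuntzBelow_of_le hhalf le_rfl).smul zero_le_two
  rwa [smul_smul, mul_one_div_cancel two_ne_zero, one_smul] at h

theorem exists_absorbing (hS : IsCuntzSemigroupOf A S) (h : HasInfiniteProjection hS.stab) :
    ∃ P Q : S, WayBelow P P ∧ Q ≠ 0 ∧ Q + P = P := by
  let := CStarAlgebra.spectralOrder hS.stab
  have := CStarAlgebra.spectralOrderedRing hS.stab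
  obtain ⟨p, v, ⟨hps, hpp⟩, hvp, hpv, hne⟩ := h
  have hps' : star p = p := hps
  have hvpv : v * p = v := by
    rw [← sub_eq_zero, ← CStarRing.star_mul_self_eq_zero_iff]
    simp only [star_sub, star_mul, hps', sub_mul, mul_sub]
    simp only [mul_assoc, hvp]
    rw [← mul_assoc (star v), hvp, hpp]
    simp [hpp]
  obtain ⟨e, he⟩ : ∃ e, e = v * star v := ⟨_, rfl⟩
  rw [← he] at hpv hne
  have hes : star e = e := by simp [he]
  have hee : e * e = e := by
    rw [he, mul_assoc, ← mul_assoc (star v), hvp, ← mul_assoc, hvpv]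
  have hep : e * p = e := by simpa [hes, hps'] using congrArg star hpv
  have hqs : star (p - e) = p - e := by rw [star_sub, hes, hps']
  have hqq : (p - e) * (p - e) = p - e := by
    rw [sub_mul, mul_sub, mul_sub, hpp, hpv, hep, hee]; simp
  have hqe : (p - e) * e = 0 := by rw [sub_mul, hpv, hee, sub_self]
  have hq0 : 0 ≤ p - e := by
    have := star_mul_self_nonneg (p - e)
    rwa [hqs, hqq] at this
  have he0 : 0 ≤ e := he ▸ mul_star_self_nonneg v
  have hp0 : 0 ≤ p := hvp ▸ star_mul_self_nonneg v
  have heq : hS.cls e = hS.cls p := le_antisymm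
    (hS.cls_le_cls he0 hp0 (by
      rw [he, ← hvp]; simpa using cuntzBelow_star_mul_self (star v)))
    (hS.cls_le_cls hp0 he0 (by rw [he, ← hvp]; exact cuntzBelow_star_mul_self v))
  refine ⟨hS.cls p, hS.cls (p - e), hS.wayBelow_cls_self hps hpp, fun h0 => hne ?_, ?_⟩
  · exact (sub_eq_zero.1 ((hS.cls_eq_zero_iff hq0).1 h0)).symm
  · rw [← heq, ← hS.cls_add_of_mul_eq_zero hq0 he0 hqe, sub_add_cancel, heq]

/-- If the stabilization of a simple C*-algebra contains an infinite projection, then its Cuntz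
semigroup has a largest element that is compact. -/
theorem exists_compact_top (hS : IsCuntzSemigroupOf A S) (hA : IsSimpleCStar A)
    (h : HasInfiniteProjection hS.stab) : ∃ P : S, WayBelow P P ∧ ∀ x, x ≤ P := by
  obtain ⟨P, Q, hPP, hQ, hQP⟩ := hS.exists_absorbing h
  have hP : P ≠ 0 := by
    rintro rfl
    exact hQ (by simpa using hQP)
  obtain ⟨N, hN⟩ := hS.exists_le_nsmul hA hQ hPP
  have habs : ∀ n : ℕ, n • Q + P = P := fun n => by
    induction n with
    | zero => simp
    | succ n ih => rw [succ_nsmul, add_assoc, hQP, ih]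
  have hmul : ∀ n : ℕ, n • P ≤ P := fun n => by
    induction n with
    | zero => simpa using CuSemigroup.zero_le' P
    | succ n ih =>
      rw [succ_nsmul]
      exact (add_le_add (ih.trans hN) le_rfl).trans (habs N).le
  refine ⟨P, hPP, fun x => ?_⟩
  obtain ⟨f, -, hwb, hx⟩ := CuSemigroup.exists_waybelow_seq x
  refine hx.2 ?_
  rintro _ ⟨k, rfl⟩
  obtain ⟨M, hM⟩ := hS.exists_le_nsmul hA hP (hwb k)
  exact hM.trans (hmul M)

end InfiniteProjection

end IsCuntzSemigroupOf

/-- Lemma 3.8.  For a simple non-elementary C*-algebra `A`, the set of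
elements of `Cu(A)` with finite weak divisibility (`wdiv_{2m}(x) < ∞` for some `m ≥ 1`)
is sup-dense in `Cu(A)`; if `A` is moreover not stably finite then it is all of
`Cu(A)`. -/
theorem wdiv_supDense_of_simple
    (A : Type) [NonUnitalCStarAlgebra A] (S : Type) [CuSemigroup S]
    (hS : IsCuntzSemigroupOf A S)
    (hsimple : IsSimpleCStar A) (hnonelem : ¬ IsElementaryCStar A) :
    (∀ x : S, ∃ f : ℕ → S, Monotone f ∧
      (∀ k, ∃ m : ℕ, 1 ≤ m ∧ CuDiv.wdiv (2 * m) (f k) < ⊤) ∧ IsLUB (Set.range f) x) ∧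
    (HasInfiniteProjection hS.stab →
      ∀ x : S, ∃ m : ℕ, 1 ≤ m ∧ CuDiv.wdiv (2 * m) x < ⊤) := by
  refine ⟨hS.exists_isLUB_wdiv_lt_top hsimple hnonelem, fun hinf x => ?_⟩
  by_cases hx0 : x = 0
  · rw [hx0]
    exact exists_wdiv_zero_lt_top
  obtain ⟨P, hPP, hP⟩ := hS.exists_compact_top hsimple hinf
  obtain ⟨d, hd0, hd⟩ := hS.exists_add_self_le hsimple hnonelem hx0
  obtain ⟨N, hN⟩ := hS.exists_le_nsmul hsimple hd0 hPP
  exact exists_wdiv_lt_top ((hP x).trans hN) hd
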